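/- arXiv:2306.17438 — 4 statements merged into one kernel-verified Lean document; each statement's English description precedes it below -/
import Mathlib

section
/- (Laczkovich–Székelyhidi) Let G be an abelian group (with the discrete topology). Spectral synthesis holds on G — that is, for every translation-invariant ℂ-linear subspace V of ℂ^G that is closed in the product (pointwise convergence) topology, the exponential monomials contained in V span a dense subspace of V — if and only if the torsion-free rank of G is finite, i.e. the ℚ-vector space ℚ ⊗_ℤ G is finite-dimensional. -/
open TensorProduct

/-- An exponential monomial on a discrete abelian group `G`: a function of the
form `x ↦ P(a₁(x),…,a_k(x))·m(x)` with the `aᵢ : G → ℂ` additive, `m : G → ℂ`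
multiplicative and nonvanishing, and `P` a complex polynomial. -/
def IsExpMonomial {G : Type*} [AddCommGroup G] (f : G → ℂ) : Prop :=
  ∃ (k : ℕ) (P : MvPolynomial (Fin k) ℂ) (a : Fin k → G → ℂ) (m : G → ℂ),
    (∀ i x y, a i (x + y) = a i x + a i y) ∧
    (∀ x y, m (x + y) = m x * m y) ∧
    (∀ x, m x ≠ 0) ∧
    ∀ x, f x = (MvPolynomial.eval fun i => a i x) P * m x

/-- Spectral synthesis on a discrete abelian group `G`: every
translation-invariant subspace of `ℂ^G` closed in the product (pointwise
convergence) topology is the closed span of the exponential monomials it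
contains. -/
def SpectralSynthesis (G : Type*) [AddCommGroup G] : Prop :=
  ∀ V : Submodule ℂ (G → ℂ), IsClosed (V : Set (G → ℂ)) →
    (∀ f ∈ V, ∀ g : G, (fun x => f (x + g)) ∈ V) →
    (V : Set (G → ℂ)) ⊆
      closure (Submodule.span ℂ {f : G → ℂ | f ∈ V ∧ IsExpMonomial f} : Set (G → ℂ))

section SecondDifferences

variable {G : Type*} [AddCommGroup G]

/-- The translates of `f` span a finite-dimensional space. -/
def HasFiniteTranslates (f : G → ℂ) : Prop :=
  ∃ W : Submodule ℂ (G → ℂ), W.FG ∧ ∀ g, (fun x => f (x + g)) ∈ W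

lemma HasFiniteTranslates.of_multiplicative {m : G → ℂ} (hm : ∀ x y, m (x + y) = m x * m y) :
    HasFiniteTranslates m := by
  refine ⟨Submodule.span ℂ {m}, Submodule.fg_span (Set.finite_singleton _), fun g => ?_⟩
  refine Submodule.mem_span_singleton.2 ⟨m g, ?_⟩
  ext x
  simp [hm, mul_comm]

lemma HasFiniteTranslates.of_additive {a : G → ℂ} (ha : ∀ x y, a (x + y) = a x + a y) :
    HasFiniteTranslates a := by
  refine ⟨Submodule.span ℂ {a, 1}, Submodule.fg_span (Set.toFinite _), fun g => ?_⟩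
  refine Submodule.mem_span_pair.2 ⟨1, a g, ?_⟩
  ext x
  simp [ha]

lemma HasFiniteTranslates.const (c : ℂ) : HasFiniteTranslates (fun _ : G => c) :=
  ⟨Submodule.span ℂ {fun _ => c}, Submodule.fg_span (Set.finite_singleton _),
    fun _ => Submodule.mem_span_singleton_self _⟩

lemma HasFiniteTranslates.add {f f' : G → ℂ} (h : HasFiniteTranslates f)
    (h' : HasFiniteTranslates f') : HasFiniteTranslates (fun x => f x + f' x) := by
  obtain ⟨W, hW, hf⟩ := h
  obtain ⟨W', hW', hf'⟩ := h'
  exact ⟨W ⊔ W', hW.sup hW', fun g => Submodule.add_mem_sup (hf g) (hf' g)⟩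

lemma HasFiniteTranslates.mul {f f' : G → ℂ} (h : HasFiniteTranslates f)
    (h' : HasFiniteTranslates f') : HasFiniteTranslates (fun x => f x * f' x) := by
  obtain ⟨W, hW, hf⟩ := h
  obtain ⟨W', hW', hf'⟩ := h'
  exact ⟨W * W', hW.mul hW', fun g => Submodule.mul_mem_mul (hf g) (hf' g)⟩

lemma IsExpMonomial.hasFiniteTranslates {f : G → ℂ} (hf : IsExpMonomial f) :
    HasFiniteTranslates f := by
  obtain ⟨k, P, a, m, ha, hm, -, hfx⟩ := hf
  have key : ∀ Q : MvPolynomial (Fin k) ℂ,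
      HasFiniteTranslates (fun x => MvPolynomial.eval (fun i => a i x) Q) := by
    intro Q
    induction Q using MvPolynomial.induction_on with
    | C c => simpa using HasFiniteTranslates.const c
    | add p q hp hq => simpa using hp.add hq
    | mul_X p i hp => simpa using hp.mul (.of_additive (ha i))
  rw [show f = _ from funext hfx]
  exact (key P).mul (.of_multiplicative hm)

/-- The functions whose second differences are a constant multiple of a given kernel `B`. -/
def secondDifferenceSpace (B : G → G → ℂ) : Submodule ℂ (G → ℂ) where
  carrier := {f | ∃ c, ∀ x y z, f (x + y + z) - f (x + y) - f (x + z) + f x = c * B y z}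
  zero_mem' := ⟨0, by simp⟩
  add_mem' := by
    rintro f f' ⟨c, hc⟩ ⟨c', hc'⟩
    refine ⟨c + c', fun x y z => ?_⟩
    simp only [Pi.add_apply]
    linear_combination hc x y z + hc' x y z
  smul_mem' := by
    rintro t f ⟨c, hc⟩
    refine ⟨t * c, fun x y z => ?_⟩
    simp only [Pi.smul_apply, smul_eq_mul]
    linear_combination t * hc x y z

lemma isClosed_secondDifferenceSpace {B : G → G → ℂ} {y₀ z₀ : G} (h₀ : B y₀ z₀ ≠ 0) :
    IsClosed (secondDifferenceSpace B : Set (G → ℂ)) := by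
  have : (secondDifferenceSpace B : Set (G → ℂ)) = ⋂ (x) (y) (z), {f : G → ℂ |
      f (x + y + z) - f (x + y) - f (x + z) + f x =
        ((f (y₀ + z₀) - f y₀ - f z₀ + f 0) / B y₀ z₀) * B y z} := by
    ext f
    simp only [Set.mem_iInter, Set.mem_ofPred_eq, SetLike.mem_coe]
    constructor
    · rintro ⟨c, hc⟩ x y z
      have := hc 0 y₀ z₀
      simp only [zero_add] at this
      rw [hc, this, mul_div_assoc, div_self h₀, mul_one]
    · intro h
      exact ⟨_, h⟩
  rw [this]
  refine isClosed_iInter fun x => isClosed_iInter fun y => isClosed_iInter fun z => ?_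
  exact isClosed_eq (by fun_prop) (by fun_prop)

/-- A biadditive kernel which is diagonal with nonzero diagonal entries on an infinite family
obstructs spectral synthesis. -/
lemma not_spectralSynthesis_of_diagonal_kernel {ι : Type*} [Infinite ι] (B : G → G → ℂ)
    (hl : ∀ x y z, B (x + y) z = B x z + B y z) (hr : ∀ x y z, B x (y + z) = B x y + B x z)
    (hs : ∀ x y, B x y = B y x) (e : ι → G) (hd : ∀ i, B (e i) (e i) ≠ 0)
    (ho : ∀ i j, i ≠ j → B (e i) (e j) = 0) : ¬ SpectralSynthesis G := by
  intro hG
  obtain ⟨i₀⟩ : Nonempty ι := inferInstance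
  have hq : (fun x => B x x) ∈ secondDifferenceSpace B :=
    ⟨2, fun x y z => by simp only [hl, hr, hs y x, hs z x, hs z y]; ring⟩
  have hmem := hG (secondDifferenceSpace B) (isClosed_secondDifferenceSpace (hd i₀))
    (by
      rintro f ⟨c, hc⟩ g
      refine ⟨c, fun x y z => ?_⟩
      rw [← hc (x + g) y z]
      congr 3 <;> grind) hq
  let T : Submodule ℂ (G → ℂ) :=
    { carrier := {f | f (e i₀ + e i₀) - f (e i₀) - f (e i₀) + f 0 = 0}
      zero_mem' := by simp
      add_mem' := by
        intro f f' hf hf'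
        simp only [Set.mem_ofPred_eq, Pi.add_apply] at *
        linear_combination hf + hf'
      smul_mem' := by
        intro t f hf
        simp only [Set.mem_ofPred_eq, Pi.smul_apply, smul_eq_mul] at *
        linear_combination t * hf }
  have hT : IsClosed (T : Set (G → ℂ)) := isClosed_eq (by fun_prop) (by fun_prop)
  have hsub : Submodule.span ℂ {f : G → ℂ | f ∈ secondDifferenceSpace B ∧ IsExpMonomial f} ≤ T := by
    rw [Submodule.span_le]
    rintro f ⟨⟨c, hc⟩, hf⟩
    have hc0 : c = 0 := by
      by_contra hc0
      obtain ⟨W, hW, hWf⟩ := hf.hasFiniteTranslates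
      let W' := W ⊔ Submodule.span ℂ {f, 1}
      have hW' : W'.FG := hW.sup (Submodule.fg_span (Set.toFinite _))
      have : FiniteDimensional ℂ W' := .of_fg hW'
      have hin : ∀ i, (fun y => c * B y (e i)) ∈ W' := by
        intro i
        have h2 : (f (e i) - f 0) • (1 : G → ℂ) + f ∈ Submodule.span ℂ {f, (1 : G → ℂ)} :=
          add_mem (Submodule.smul_mem _ _ (Submodule.subset_span (by simp)))
            (Submodule.subset_span (by simp))
        have := Submodule.sub_mem _ (Submodule.mem_sup_left (hWf (e i)) : _ ∈ W')
          (Submodule.mem_sup_right h2 : _ ∈ W')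
        convert this using 1
        ext y
        have h3 := hc 0 y (e i)
        simp only [zero_add] at h3
        simp [← h3]
        ring
      have hli : LinearIndependent ℂ (fun i => (⟨_, hin i⟩ : W')) := by
        refine LinearIndependent.of_comp W'.subtype ?_
        rw [linearIndependent_iff']
        intro s w hw i hi
        have h4 := congrFun hw (e i)
        simp only [Function.comp_apply, Submodule.subtype_apply, Finset.sum_apply, Pi.smul_apply,
          smul_eq_mul, Pi.zero_apply] at h4
        rw [Finset.sum_eq_single i] at h4
        · simpa [hc0, hd] using h4
        · intro j _ hj
          simp [ho i j hj.symm]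
        · exact fun h => absurd hi h
      have := hli.finite
      exact not_finite ι
    have := hc 0 (e i₀) (e i₀)
    rw [zero_add, hc0, zero_mul] at this
    exact this
  have hfin : (fun x => B x x) ∈ T :=
    closure_minimal (show _ ⊆ (T : Set (G → ℂ)) from hsub) hT hmem
  have h5 : B (e i₀ + e i₀) (e i₀ + e i₀) - B (e i₀) (e i₀) - B (e i₀) (e i₀) + B 0 0 = 0 := hfin
  have h6 : B 0 0 = 0 := by simpa using hl 0 0 0
  simp only [hl, hr, h6] at h5
  refine hd i₀ ?_
  linear_combination h5 / 2

end SecondDifferences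

section TorsionFreeRank

variable {G : Type*} [AddCommGroup G]

lemma exists_nsmul_eq_one_tmul (w : ℚ ⊗[ℤ] G) :
    ∃ n : ℕ, n ≠ 0 ∧ ∃ g : G, n • w = (1 : ℚ) ⊗ₜ[ℤ] g := by
  induction w using TensorProduct.induction_on with
  | zero => exact ⟨1, one_ne_zero, 0, by simp⟩
  | tmul q g =>
    refine ⟨q.den, q.den_nz, q.num • g, ?_⟩
    rw [TensorProduct.tmul_smul, TensorProduct.smul_tmul', TensorProduct.smul_tmul']
    congr 1
    simp [Rat.den_mul_eq_num]
  | add x y hx hy =>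
    obtain ⟨n, hn, g, hg⟩ := hx
    obtain ⟨n', hn', g', hg'⟩ := hy
    refine ⟨n * n', mul_ne_zero hn hn', n' • g + n • g', ?_⟩
    rw [TensorProduct.tmul_add, TensorProduct.tmul_smul, TensorProduct.tmul_smul, ← hg, ← hg',
      smul_add, smul_smul, smul_smul, mul_comm n' n]

lemma finiteDimensional_of_spectralSynthesis (hG : SpectralSynthesis G) :
    FiniteDimensional ℚ (ℚ ⊗[ℤ] G) := by
  classical
  let b := Module.Basis.ofVectorSpace ℚ (ℚ ⊗[ℤ] G)
  by_contra hfin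
  have : Infinite (Module.Basis.ofVectorSpaceIndex ℚ (ℚ ⊗[ℤ] G)) := by
    by_contra h
    rw [not_infinite_iff_finite] at h
    exact hfin (Module.Finite.of_basis b)
  choose n hn e he using fun i => exists_nsmul_eq_one_tmul (b i)
  let B : G → G → ℂ := fun x y => (b.toDual ((1 : ℚ) ⊗ₜ[ℤ] x) ((1 : ℚ) ⊗ₜ[ℤ] y) : ℚ)
  have hsym : ∀ v w, b.toDual v w = b.toDual w v := by
    intro v w
    have : b.toDual = b.toDual.flip := by
      refine b.ext fun i => b.ext fun j => ?_
      simp [Module.Basis.toDual_apply, eq_comm]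
    conv_lhs => rw [this]
    rfl
  refine not_spectralSynthesis_of_diagonal_kernel B ?_ ?_ ?_ e ?_ ?_ hG
  · intro x y z
    simp [B, TensorProduct.tmul_add]
  · intro x y z
    simp [B, TensorProduct.tmul_add]
  · intro x y
    simp only [B]
    rw [hsym]
  · intro i
    simp [B, ← he, Module.Basis.toDual_apply, hn]
  · intro i j hij
    simp [B, ← he, Module.Basis.toDual_apply, hij]

end TorsionFreeRank

section BinomialHom

open MvPowerSeries

variable {G : Type*} [AddCommGroup G] {r : ℕ}

/-- The formal power series `∏ i, (1 + X i) ^ (c i)`. -/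
noncomputable def mvBinomialSeries (c : Fin r → ℂ) : MvPowerSeries (Fin r) ℂ :=
  ∏ i, rename (fun _ : Unit => i) (PowerSeries.binomialSeries ℂ (c i))

lemma mvBinomialSeries_zero : mvBinomialSeries (0 : Fin r → ℂ) = 1 := by
  simp [mvBinomialSeries]

lemma mvBinomialSeries_add (c d : Fin r → ℂ) :
    mvBinomialSeries (c + d) = mvBinomialSeries c * mvBinomialSeries d := by
  simp [mvBinomialSeries, Finset.prod_mul_distrib]

lemma mvBinomialSeries_single (i : Fin r) :
    mvBinomialSeries (Pi.single i (1 : ℂ)) = 1 + X i := by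
  have h1 : PowerSeries.binomialSeries ℂ (1 : ℂ) = 1 + PowerSeries.X := by
    simpa using PowerSeries.binomialSeries_nat (R := ℂ) (A := ℂ) 1
  rw [mvBinomialSeries, Finset.prod_eq_single i]
  · rw [Pi.single_eq_same, h1, map_add, map_one, PowerSeries.X, rename_X]
  · intro j _ hj
    simp [hj]
  · simp

lemma constantCoeff_mvBinomialSeries (c : Fin r → ℂ) :
    constantCoeff (mvBinomialSeries c) = 1 := by
  rw [mvBinomialSeries, map_prod]
  refine Finset.prod_eq_one fun i _ => ?_
  rw [constantCoeff_rename]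
  exact PowerSeries.binomialSeries_constantCoeff (c i)

lemma exists_eval_eq_choose (n : ℕ) :
    ∃ p : Polynomial ℂ, ∀ c : ℂ, p.eval c = Ring.choose c n := by
  refine ⟨(n.factorial : ℂ)⁻¹ • (descPochhammer ℤ n).map (algebraMap ℤ ℂ), fun c => ?_⟩
  rw [Ring.choose_eq_smul, Polynomial.eval_smul, Polynomial.eval_map_algebraMap,
    Polynomial.aeval_eq_smeval]

lemma exists_eval_eq_coeff_mvBinomialSeries (x : Fin r →₀ ℕ) :
    ∃ P : MvPolynomial (Fin r) ℂ, ∀ c : Fin r → ℂ,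
      MvPolynomial.eval c P = coeff x (mvBinomialSeries c) := by
  classical
  choose p hp using exists_eval_eq_choose
  have key : ∀ (i : Fin r) (y : Fin r →₀ ℕ), ∃ P : MvPolynomial (Fin r) ℂ, ∀ c : Fin r → ℂ,
      MvPolynomial.eval c P =
        coeff y (rename (fun _ : Unit => i) (PowerSeries.binomialSeries ℂ (c i))) := by
    intro i y
    simp only [coeff_rename]
    refine ⟨∑ d ∈ (Filter.TendstoCofinite.finite_preimage_singleton
      (Finsupp.mapDomain fun _ : Unit => i) y).toFinset,
      Polynomial.aeval (MvPolynomial.X i) (p (d ())), fun c => ?_⟩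
    rw [map_sum]
    refine Finset.sum_congr rfl fun d _ => ?_
    have hd : coeff d (PowerSeries.binomialSeries ℂ (c i)) = Ring.choose (c i) (d ()) := by
      have := PowerSeries.binomialSeries_coeff (A := ℂ) (c i) (d ())
      rw [PowerSeries.coeff, ← Finsupp.unique_single d] at this
      simpa using this
    rw [hd, ← hp, ← MvPolynomial.coe_aeval_eq_eval, RingHom.coe_coe,
      ← Polynomial.aeval_algHom_apply]
    simp
  choose Q hQ using key
  refine ⟨∑ l ∈ Finset.finsuppAntidiag Finset.univ x, ∏ i, Q i (l i), fun c => ?_⟩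
  rw [mvBinomialSeries, coeff_prod]
  simp [hQ]

lemma algHom_ext_single {A : Type*} [CommRing A] [Algebra ℂ A]
    {φ ψ : AddMonoidAlgebra ℂ G →ₐ[ℂ] A}
    (h : ∀ g, φ (AddMonoidAlgebra.single g 1) = ψ (AddMonoidAlgebra.single g 1)) : φ = ψ :=
  AddMonoidAlgebra.algHom_ext h (Subsingleton.elim _ _)

lemma algHom_single_zero {A : Type*} [CommRing A] [Algebra ℂ A]
    (ε : AddMonoidAlgebra ℂ G →ₐ[ℂ] A) :
    ε (AddMonoidAlgebra.single 0 1) = 1 :=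
  map_one ε

lemma algHom_single_add {A : Type*} [CommRing A] [Algebra ℂ A]
    (ε : AddMonoidAlgebra ℂ G →ₐ[ℂ] A) (g h : G) : ε (AddMonoidAlgebra.single (g + h) 1) =
      ε (AddMonoidAlgebra.single g 1) * ε (AddMonoidAlgebra.single h 1) := by
  rw [← map_mul, AddMonoidAlgebra.single_mul_single, one_mul]

lemma algHom_single_ne_zero {A : Type*} [CommRing A] [Algebra ℂ A] [Nontrivial A]
    (ε : AddMonoidAlgebra ℂ G →ₐ[ℂ] A) (g : G) : ε (AddMonoidAlgebra.single g 1) ≠ 0 := by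
  intro h
  have := algHom_single_add ε g (-g)
  rw [h, zero_mul, add_neg_cancel, algHom_single_zero] at this
  exact one_ne_zero this

/-- The algebra homomorphism sending the group element `g` to
`m g * ∏ i, (1 + X i) ^ (a i g)`, where `m` is the character underlying `ε`. -/
noncomputable def binomialHom (a : Fin r → G →+ ℂ) (ε : AddMonoidAlgebra ℂ G →ₐ[ℂ] ℂ) :
    AddMonoidAlgebra ℂ G →ₐ[ℂ] MvPowerSeries (Fin r) ℂ :=
  AddMonoidAlgebra.lift ℂ _ G
    { toFun := fun g => ε (AddMonoidAlgebra.single g.toAdd 1) •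
        mvBinomialSeries (fun i => a i g.toAdd)
      map_one' := by
        rw [toAdd_one, algHom_single_zero, one_smul]
        simpa [Pi.zero_def] using mvBinomialSeries_zero (r := r)
      map_mul' := fun g h => by
        rw [toAdd_mul, algHom_single_add, smul_mul_smul_comm, ← mvBinomialSeries_add]
        simp [Pi.add_def] }

lemma binomialHom_single (a : Fin r → G →+ ℂ) (ε : AddMonoidAlgebra ℂ G →ₐ[ℂ] ℂ) (g : G) :
    binomialHom a ε (AddMonoidAlgebra.single g 1) =
      ε (AddMonoidAlgebra.single g 1) • mvBinomialSeries (fun i => a i g) := by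
  simp [binomialHom]

lemma constantCoeff_binomialHom (a : Fin r → G →+ ℂ) (ε : AddMonoidAlgebra ℂ G →ₐ[ℂ] ℂ)
    (f : AddMonoidAlgebra ℂ G) : constantCoeff (binomialHom a ε f) = ε f := by
  let κ : MvPowerSeries (Fin r) ℂ →ₐ[ℂ] ℂ :=
    { constantCoeff with commutes' := fun c => by simp [MvPowerSeries.algebraMap_apply] }
  have : κ.comp (binomialHom a ε) = ε := by
    refine algHom_ext_single fun g => ?_
    simp [κ, binomialHom_single, constantCoeff_mvBinomialSeries, smul_eq_C_mul]
  exact DFunLike.congr_fun this f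

/-- A finite linear combination of coefficients of `binomialHom` is an exponential monomial. -/
lemma isExpMonomial_dual_truncTotal_binomialHom (a : Fin r → G →+ ℂ)
    (ε : AddMonoidAlgebra ℂ G →ₐ[ℂ] ℂ) (k : ℕ) (l : MvPolynomial (Fin r) ℂ →ₗ[ℂ] ℂ) :
    IsExpMonomial fun g : G =>
      l (truncTotal k (binomialHom a ε (AddMonoidAlgebra.single g 1))) := by
  choose P hP using exists_eval_eq_coeff_mvBinomialSeries (r := r)
  refine ⟨r, ∑ x ∈ (Finsupp.finite_of_degree_lt (σ := Fin r) k).toFinset,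
    l (MvPolynomial.monomial x 1) • P x, fun i => a i,
    fun g => ε (AddMonoidAlgebra.single g 1), fun i => map_add (a i), algHom_single_add ε,
    algHom_single_ne_zero ε, fun g => ?_⟩
  dsimp only
  rw [binomialHom_single, map_smul, map_smul, truncTotal, truncFinset_apply, map_sum, map_sum,
    smul_eq_mul, mul_comm]
  congr 1
  refine Finset.sum_congr rfl fun x _ => ?_
  rw [← mul_one (coeff x _), ← smul_eq_mul, ← MvPolynomial.smul_monomial, map_smul,
    MvPolynomial.smul_eval, hP, smul_eq_mul, mul_comm]

end BinomialHom

section Filtration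

open MvPowerSeries

variable {G : Type*} [AddCommGroup G] {r : ℕ}

/-- The additive functions `a` and the elements `e` form a dual pair of bases of `ℚ ⊗ G`. -/
structure IsRationalBasis (a : Fin r → G →+ ℂ) (e : Fin r → G) : Prop where
  apply_eq_single : ∀ j, (fun i => a i (e j)) = Pi.single j 1
  exists_nsmul_eq : ∀ g, ∃ n : ℕ, n ≠ 0 ∧ ∃ z : Fin r → ℤ, n • g = ∑ i, z i • e i

/-- The group element `g`, normalised by the character underlying `ε`, minus one. -/
noncomputable def normalizedSubOne (ε : AddMonoidAlgebra ℂ G →ₐ[ℂ] ℂ) (g : G) :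
    AddMonoidAlgebra ℂ G :=
  (ε (AddMonoidAlgebra.single g 1))⁻¹ • AddMonoidAlgebra.single g 1 - 1

lemma apply_normalizedSubOne (ε : AddMonoidAlgebra ℂ G →ₐ[ℂ] ℂ) (g : G) :
    ε (normalizedSubOne ε g) = 0 := by
  rw [normalizedSubOne, map_sub, map_smul, smul_eq_mul,
    inv_mul_cancel₀ (algHom_single_ne_zero ε g), map_one, sub_self]

lemma normalizedSubOne_mem_ker (ε : AddMonoidAlgebra ℂ G →ₐ[ℂ] ℂ) (g : G) :
    normalizedSubOne ε g ∈ RingHom.ker ε :=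
  apply_normalizedSubOne ε g

lemma normalizedSubOne_add (ε : AddMonoidAlgebra ℂ G →ₐ[ℂ] ℂ) (g h : G) :
    normalizedSubOne ε (g + h) = normalizedSubOne ε g + normalizedSubOne ε h +
      normalizedSubOne ε g * normalizedSubOne ε h := by
  have h1 : (AddMonoidAlgebra.single (g + h) 1 : AddMonoidAlgebra ℂ G) =
      AddMonoidAlgebra.single g 1 * AddMonoidAlgebra.single h 1 := by
    rw [AddMonoidAlgebra.single_mul_single, one_mul]
  rw [normalizedSubOne, algHom_single_add, mul_inv, h1, ← smul_mul_smul_comm]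
  simp only [normalizedSubOne]
  ring

lemma single_eq_smul_normalizedSubOne (ε : AddMonoidAlgebra ℂ G →ₐ[ℂ] ℂ) (g : G) (c : ℂ) :
    AddMonoidAlgebra.single g c = (c * ε (AddMonoidAlgebra.single g 1)) • normalizedSubOne ε g +
      algebraMap ℂ _ (ε (AddMonoidAlgebra.single g c)) := by
  have h1 : (AddMonoidAlgebra.single g c : AddMonoidAlgebra ℂ G) =
      c • AddMonoidAlgebra.single g 1 := by simp
  rw [h1, map_smul, smul_eq_mul, normalizedSubOne, smul_sub, smul_smul, mul_assoc,
    mul_inv_cancel₀ (algHom_single_ne_zero ε g), mul_one, Algebra.algebraMap_eq_smul_one,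
    sub_add_cancel]

lemma sub_algebraMap_mem_span (ε : AddMonoidAlgebra ℂ G →ₐ[ℂ] ℂ) (f : AddMonoidAlgebra ℂ G) :
    f - algebraMap ℂ _ (ε f) ∈ Submodule.span ℂ (Set.range (normalizedSubOne ε)) := by
  induction f using AddMonoidAlgebra.induction_linear with
  | zero => simp
  | add f g hf hg =>
    convert add_mem hf hg using 1
    simp only [map_add]
    ring
  | single g c =>
    rw [sub_eq_of_eq_add (single_eq_smul_normalizedSubOne ε g c)]
    exact Submodule.smul_mem _ _ (Submodule.subset_span ⟨g, rfl⟩)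

/-- The additive map from `G` to the Zariski cotangent space at `ε`. -/
noncomputable def cotangentHom (ε : AddMonoidAlgebra ℂ G →ₐ[ℂ] ℂ) :
    G →+ AddMonoidAlgebra ℂ G ⧸ RingHom.ker ε ^ 2 :=
  AddMonoidHom.mk' (fun g => Ideal.Quotient.mk _ (normalizedSubOne ε g)) fun g h => by
    rw [normalizedSubOne_add, map_add, map_add, add_eq_left, Ideal.Quotient.eq_zero_iff_mem, sq]
    exact Ideal.mul_mem_mul (normalizedSubOne_mem_ker ε g) (normalizedSubOne_mem_ker ε h)

variable {a : Fin r → G →+ ℂ} {e : Fin r → G}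

lemma IsRationalBasis.exists_sum_sub_mem_ker_sq (h : IsRationalBasis a e)
    (ε : AddMonoidAlgebra ℂ G →ₐ[ℂ] ℂ) {f : AddMonoidAlgebra ℂ G} (hf : ε f = 0) :
    ∃ c : Fin r → ℂ, f - ∑ i, c i • normalizedSubOne ε (e i) ∈ RingHom.ker ε ^ 2 := by
  let π := Ideal.Quotient.mkₐ ℂ (RingHom.ker ε ^ 2)
  let D : Submodule ℂ (AddMonoidAlgebra ℂ G ⧸ RingHom.ker ε ^ 2) :=
    Submodule.span ℂ (Set.range fun i => cotangentHom ε (e i))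
  have hD : ∀ g, cotangentHom ε g ∈ D := by
    intro g
    obtain ⟨n, hn, z, hz⟩ := h.exists_nsmul_eq g
    have h1 : n • cotangentHom ε g = ∑ i, z i • cotangentHom ε (e i) := by
      rw [← map_nsmul, hz, map_sum]
      simp
    have h2 : n • cotangentHom ε g ∈ D := by
      rw [h1]
      exact sum_mem fun i _ => zsmul_mem (Submodule.subset_span (Set.mem_range_self i)) _
    rw [← Nat.cast_smul_eq_nsmul ℂ] at h2
    exact (D.smul_mem_iff (Nat.cast_ne_zero.2 hn)).1 h2
  have hfD : π f ∈ D := by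
    have h3 := sub_algebraMap_mem_span ε f
    rw [hf, map_zero, sub_zero] at h3
    have h4 : Submodule.span ℂ (Set.range (normalizedSubOne ε)) ≤ D.comap π.toLinearMap := by
      rw [Submodule.span_le]
      rintro _ ⟨g, rfl⟩
      exact hD g
    exact h4 h3
  obtain ⟨c, hc⟩ := (Submodule.mem_span_range_iff_exists_fun ℂ).1 hfD
  refine ⟨c, ?_⟩
  rw [← Ideal.Quotient.eq_zero_iff_mem]
  change π (f - ∑ i, c i • normalizedSubOne ε (e i)) = 0
  rw [map_sub, map_sum, ← hc, sub_eq_zero]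
  simp only [map_smul]
  rfl

lemma IsRationalBasis.binomialHom_normalizedSubOne (h : IsRationalBasis a e)
    (ε : AddMonoidAlgebra ℂ G →ₐ[ℂ] ℂ) (i : Fin r) :
    binomialHom a ε (normalizedSubOne ε (e i)) = X i := by
  rw [normalizedSubOne, map_sub, map_smul, binomialHom_single, h.apply_eq_single,
    mvBinomialSeries_single, smul_smul, inv_mul_cancel₀ (algHom_single_ne_zero ε _), map_one]
  simp

/-- Substitution of the elements `normalizedSubOne ε (e i)` in polynomials. -/
noncomputable def polynomialHom (e : Fin r → G) (ε : AddMonoidAlgebra ℂ G →ₐ[ℂ] ℂ) :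
    MvPolynomial (Fin r) ℂ →ₐ[ℂ] AddMonoidAlgebra ℂ G :=
  MvPolynomial.aeval fun i => normalizedSubOne ε (e i)

lemma IsRationalBasis.binomialHom_polynomialHom (h : IsRationalBasis a e)
    (ε : AddMonoidAlgebra ℂ G →ₐ[ℂ] ℂ) (q : MvPolynomial (Fin r) ℂ) :
    binomialHom a ε (polynomialHom e ε q) = q := by
  have : (binomialHom a ε).comp (polynomialHom e ε) =
      MvPolynomial.coeToMvPowerSeries.algHom ℂ := by
    refine MvPolynomial.algHom_ext fun i => ?_
    simp [polynomialHom, h.binomialHom_normalizedSubOne]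
  simpa using DFunLike.congr_fun this q

lemma IsRationalBasis.exists_polynomialHom_sub_mem (h : IsRationalBasis a e)
    (ε : AddMonoidAlgebra ℂ G →ₐ[ℂ] ℂ) (k : ℕ) {f : AddMonoidAlgebra ℂ G}
    (hf : f ∈ RingHom.ker ε ^ k) :
    ∃ q, f - polynomialHom e ε q ∈ RingHom.ker ε ^ (k + 1) := by
  induction k generalizing f with
  | zero =>
    refine ⟨MvPolynomial.C (ε f), ?_⟩
    have h1 : polynomialHom e ε (MvPolynomial.C (ε f)) = algebraMap ℂ _ (ε f) :=
      (polynomialHom e ε).commutes (ε f)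
    rw [zero_add, pow_one, RingHom.mem_ker, map_sub, h1, AlgHom.commutes]
    exact sub_self _
  | succ k ih =>
    rw [pow_succ'] at hf
    induction hf using Submodule.mul_induction_on' with
    | mem_mul_mem f hf g hg =>
      obtain ⟨q, hq⟩ := ih hg
      obtain ⟨c, hc⟩ := h.exists_sum_sub_mem_ker_sq ε hf
      refine ⟨(∑ i, c i • MvPolynomial.X i) * q, ?_⟩
      have hu : polynomialHom e ε (∑ i, c i • MvPolynomial.X i) =
          ∑ i, c i • normalizedSubOne ε (e i) := by
        simp [polynomialHom]
      rw [map_mul, hu]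
      have hu' : ∑ i, c i • normalizedSubOne ε (e i) ∈ RingHom.ker ε :=
        sum_mem fun i _ => (RingHom.ker ε).smul_of_tower_mem (c i)
          (normalizedSubOne_mem_ker ε (e i))
      have h1 := Ideal.mul_mem_mul hc hg
      have h2 := Ideal.mul_mem_mul hu' hq
      rw [← pow_add, add_comm 2 k] at h1
      rw [← pow_succ'] at h2
      convert add_mem h1 h2 using 1
      ring
    | add f _ g _ hf hg =>
      obtain ⟨p, hp⟩ := hf
      obtain ⟨q, hq⟩ := hg
      refine ⟨p + q, ?_⟩
      convert add_mem hp hq using 1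
      rw [map_add]
      ring

lemma IsRationalBasis.exists_polynomialHom_sub_mem_pow (h : IsRationalBasis a e)
    (ε : AddMonoidAlgebra ℂ G →ₐ[ℂ] ℂ) (k : ℕ) (f : AddMonoidAlgebra ℂ G) :
    ∃ q, f - polynomialHom e ε q ∈ RingHom.ker ε ^ k := by
  induction k with
  | zero => exact ⟨0, by simp⟩
  | succ k ih =>
    obtain ⟨p, hp⟩ := ih
    obtain ⟨q, hq⟩ := h.exists_polynomialHom_sub_mem ε k hp
    refine ⟨p + q, ?_⟩
    rwa [map_add, ← sub_sub]

/-- The power series of order at least `k`. -/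
noncomputable def orderIdeal (r k : ℕ) : Ideal (MvPowerSeries (Fin r) ℂ) where
  carrier := {p | k ≤ p.order}
  zero_mem' := by simp
  add_mem' hp hq := (le_min hp hq).trans min_order_le_add
  smul_mem' c p hp := by
    have h1 : (k : ℕ∞) ≤ p.order := hp
    exact (h1.trans le_add_self).trans le_order_mul

lemma mem_orderIdeal {k : ℕ} {p : MvPowerSeries (Fin r) ℂ} :
    p ∈ orderIdeal r k ↔ ∀ x : Fin r →₀ ℕ, x.degree < k → coeff x p = 0 :=
  ⟨fun h _ hx => coeff_of_lt_order (lt_of_lt_of_le (by exact_mod_cast hx) h), nat_le_order⟩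

lemma pow_ker_le_comap_orderIdeal (a : Fin r → G →+ ℂ) (ε : AddMonoidAlgebra ℂ G →ₐ[ℂ] ℂ)
    (k : ℕ) : RingHom.ker ε ^ k ≤ (orderIdeal r k).comap (binomialHom a ε) := by
  induction k with
  | zero =>
    intro f _
    rw [Ideal.mem_comap, mem_orderIdeal]
    simp
  | succ k ih =>
    rw [pow_succ, Ideal.mul_le]
    intro f hf g hg
    have hf' : (k : ℕ∞) ≤ (binomialHom a ε f).order := ih hf
    have hg' : 1 ≤ (binomialHom a ε g).order := by
      rw [one_le_order_iff_constCoeff_eq_zero, constantCoeff_binomialHom]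
      exact hg
    change ((k + 1 : ℕ) : ℕ∞) ≤ (binomialHom a ε (f * g)).order
    rw [map_mul]
    push_cast
    exact (add_le_add hf' hg').trans le_order_mul

lemma sub_truncTotal_mem_orderIdeal (k : ℕ) (p : MvPowerSeries (Fin r) ℂ) :
    p - (truncTotal k p : MvPolynomial (Fin r) ℂ) ∈ orderIdeal r k := by
  rw [mem_orderIdeal]
  intro x hx
  simp [coeff_truncTotal _ hx]

lemma polynomialHom_mem_pow (e : Fin r → G) (ε : AddMonoidAlgebra ℂ G →ₐ[ℂ] ℂ) {k : ℕ}
    {q : MvPolynomial (Fin r) ℂ} (hq : (q : MvPowerSeries (Fin r) ℂ) ∈ orderIdeal r k) :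
    polynomialHom e ε q ∈ RingHom.ker ε ^ k := by
  have h1 : q ∈ MvPolynomial.idealOfVars (Fin r) ℂ ^ k := by
    rw [MvPolynomial.mem_pow_idealOfVars_iff']
    simpa [mem_orderIdeal] using hq
  have h2 : (MvPolynomial.idealOfVars (Fin r) ℂ).map (polynomialHom e ε) ≤ RingHom.ker ε := by
    rw [MvPolynomial.idealOfVars, Ideal.map_span, Ideal.span_le]
    rintro _ ⟨_, ⟨i, rfl⟩, rfl⟩
    simpa [polynomialHom] using normalizedSubOne_mem_ker ε (e i)
  have h3 := Ideal.mem_map_of_mem (polynomialHom e ε) h1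
  rw [Ideal.map_pow] at h3
  exact Ideal.pow_right_mono h2 k h3

lemma IsRationalBasis.binomialHom_mem_orderIdeal_iff (h : IsRationalBasis a e)
    (ε : AddMonoidAlgebra ℂ G →ₐ[ℂ] ℂ) {k : ℕ} {f : AddMonoidAlgebra ℂ G} :
    binomialHom a ε f ∈ orderIdeal r k ↔ f ∈ RingHom.ker ε ^ k := by
  refine ⟨fun hf => ?_, fun hf => pow_ker_le_comap_orderIdeal a ε k hf⟩
  obtain ⟨q, hq⟩ := h.exists_polynomialHom_sub_mem_pow ε k f
  have h1 : binomialHom a ε (f - polynomialHom e ε q) ∈ orderIdeal r k :=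
    pow_ker_le_comap_orderIdeal a ε k hq
  rw [map_sub, h.binomialHom_polynomialHom] at h1
  have h2 := polynomialHom_mem_pow e ε ((Submodule.sub_mem_iff_right _ hf).1 h1)
  simpa using add_mem hq h2

end Filtration

section Points

variable {G : Type*} [AddCommGroup G] {r : ℕ}

lemma one_tmul_eq_zero_iff {g : G} : (1 : ℚ) ⊗ₜ[ℤ] g = 0 ↔ ∃ m : ℤ, m ≠ 0 ∧ m • g = 0 := by
  have : IsLocalizedModule (nonZeroDivisors ℤ) (TensorProduct.mk ℤ ℚ G 1) :=
    (isLocalizedModule_iff_isBaseChange _ ℚ _).2 (TensorProduct.isBaseChange _ _ _)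
  refine (IsLocalizedModule.eq_zero_iff (nonZeroDivisors ℤ) (TensorProduct.mk ℤ ℚ G 1)).trans ?_
  simp [Submonoid.smul_def]

lemma exists_isRationalBasis [FiniteDimensional ℚ (ℚ ⊗[ℤ] G)] :
    ∃ (r : ℕ) (a : Fin r → G →+ ℂ) (e : Fin r → G), IsRationalBasis a e := by
  let b := Module.finBasis ℚ (ℚ ⊗[ℤ] G)
  choose n hn e he using fun i => exists_nsmul_eq_one_tmul (b i)
  refine ⟨_, fun i => AddMonoidHom.mk' (fun g => ((b.repr (1 ⊗ₜ[ℤ] g) i / n i : ℚ) : ℂ))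
    fun x y => ?_, e, fun j => ?_, fun g => ?_⟩
  · rw [TensorProduct.tmul_add, map_add, Finsupp.add_apply, add_div, Rat.cast_add]
  · ext i
    rw [AddMonoidHom.mk'_apply, ← he, map_nsmul, b.repr_self]
    rcases eq_or_ne i j with rfl | hij
    · simp [hn]
    · simp [hij]
  · obtain ⟨d, hd⟩ := IsLocalization.exist_integer_multiples_of_finite (nonZeroDivisors ℤ)
      fun i => b.repr (1 ⊗ₜ[ℤ] g) i / n i
    choose z hz using hd
    have h1 : (1 : ℚ) ⊗ₜ[ℤ] ((d : ℤ) • g - ∑ i, z i • e i) = 0 := by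
      rw [TensorProduct.tmul_sub, TensorProduct.tmul_sum, TensorProduct.tmul_smul, sub_eq_zero]
      conv_lhs => rw [← b.sum_repr (1 ⊗ₜ[ℤ] g)]
      rw [Finset.smul_sum]
      refine Finset.sum_congr rfl fun i _ => ?_
      have h2 : (z i : ℚ) = d * (b.repr (1 ⊗ₜ[ℤ] g) i / n i) := by simpa using hz i
      rw [TensorProduct.tmul_smul, ← he, ← Int.cast_smul_eq_zsmul ℚ, ← Int.cast_smul_eq_zsmul ℚ,
        h2, ← Nat.cast_smul_eq_nsmul ℚ, smul_smul, smul_smul, mul_assoc,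
        div_mul_cancel₀ _ (Nat.cast_ne_zero.2 (hn i))]
    obtain ⟨m, hm, h2⟩ := one_tmul_eq_zero_iff.1 h1
    have hmd : m * d ≠ 0 := mul_ne_zero hm (nonZeroDivisors.coe_ne_zero d)
    rw [smul_sub, sub_eq_zero, smul_smul] at h2
    refine ⟨(m * d).natAbs * (m * d).natAbs, by simpa using hmd, fun i => m * d * m * z i, ?_⟩
    rw [← natCast_zsmul, Nat.cast_mul, Int.natAbs_mul_self', mul_smul, h2, Finset.smul_sum,
      Finset.smul_sum]
    simp only [smul_smul, mul_assoc]

variable {a : Fin r → G →+ ℂ} {e : Fin r → G}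

lemma IsRationalBasis.isIntegral_quotient (h : IsRationalBasis a e)
    {K : Type*} [Field K] [Algebra ℂ K] (π : AddMonoidAlgebra ℂ G →ₐ[ℂ] K)
    (hπ : Function.Surjective π) : Algebra.IsIntegral ℂ K := by
  let S : Set K := Set.range (fun i => π (AddMonoidAlgebra.single (e i) 1)) ∪
    Set.range (fun i => π (AddMonoidAlgebra.single (-e i) 1))
  let A := Algebra.adjoin ℂ S
  have hzsmul : ∀ i (z : ℤ), π (AddMonoidAlgebra.single (z • e i) 1) ∈ A := by
    intro i z
    have hnat : ∀ (g : G) (n : ℕ), π (AddMonoidAlgebra.single g 1) ∈ A →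
        π (AddMonoidAlgebra.single (n • g) 1) ∈ A := by
      intro g n hg
      have : (AddMonoidAlgebra.single (n • g) 1 : AddMonoidAlgebra ℂ G) =
        AddMonoidAlgebra.single g 1 ^ n := by simp [AddMonoidAlgebra.single_pow]
      rw [this, map_pow]
      exact pow_mem hg n
    obtain ⟨n, rfl | rfl⟩ := z.eq_nat_or_neg
    · rw [natCast_zsmul]
      exact hnat _ n (Algebra.subset_adjoin (Or.inl ⟨i, rfl⟩))
    · rw [neg_smul, natCast_zsmul, ← smul_neg]
      exact hnat _ n (Algebra.subset_adjoin (Or.inr ⟨i, rfl⟩))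
  have hsum : ∀ (s : Finset (Fin r)) (z : Fin r → ℤ),
      π (AddMonoidAlgebra.single (∑ i ∈ s, z i • e i) 1) ∈ A := by
    classical
    intro s z
    induction s using Finset.induction_on with
    | empty => simp [algHom_single_zero]
    | insert i s hi ih =>
      rw [Finset.sum_insert hi, algHom_single_add]
      exact mul_mem (hzsmul i (z i)) ih
  have hint : Algebra.IsIntegral A K := by
    refine ⟨fun x => ?_⟩
    obtain ⟨f, rfl⟩ := hπ x
    induction f using AddMonoidAlgebra.induction_linear with
    | zero => simpa using isIntegral_zero
    | add f g hf hg => simpa using hf.add hg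
    | single g c =>
      have h1 : (AddMonoidAlgebra.single g c : AddMonoidAlgebra ℂ G) =
        c • AddMonoidAlgebra.single g 1 := by simp
      rw [h1, map_smul]
      refine IsIntegral.smul c ?_
      obtain ⟨n, hn, z, hz⟩ := h.exists_nsmul_eq g
      refine IsIntegral.of_pow (Nat.pos_of_ne_zero hn) ?_
      have h2 : (AddMonoidAlgebra.single g 1 : AddMonoidAlgebra ℂ G) ^ n =
        AddMonoidAlgebra.single (n • g) 1 := by simp [AddMonoidAlgebra.single_pow]
      rw [← map_pow, h2, hz]
      exact isIntegral_algebraMap (R := A) (A := K) (x := ⟨_, hsum Finset.univ z⟩)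
  have hA : IsField A := isField_of_isIntegral_of_isField (FaithfulSMul.algebraMap_injective A K)
    (Field.toIsField K)
  let _ := hA.toField
  have hft : Algebra.FiniteType ℂ A :=
    Algebra.FiniteType.adjoin_of_finite ((Set.finite_range _).union (Set.finite_range _))
  have hfin : Module.Finite ℂ A := finite_of_finite_type_of_isJacobsonRing ℂ A
  exact Algebra.IsIntegral.trans A

lemma IsRationalBasis.exists_algHom_ker_eq (h : IsRationalBasis a e)
    (M : Ideal (AddMonoidAlgebra ℂ G)) [hM : M.IsMaximal] :
    ∃ ε : AddMonoidAlgebra ℂ G →ₐ[ℂ] ℂ, RingHom.ker ε = M := by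
  let _ := Ideal.Quotient.field M
  have hint := h.isIntegral_quotient (Ideal.Quotient.mkₐ ℂ M) (Ideal.Quotient.mkₐ_surjective ℂ M)
  let φ := AlgEquiv.ofBijective (Algebra.ofId ℂ (AddMonoidAlgebra ℂ G ⧸ M))
    (IsAlgClosed.algebraMap_bijective_of_isIntegral)
  refine ⟨φ.symm.toAlgHom.comp (Ideal.Quotient.mkₐ ℂ M), ?_⟩
  ext x
  simp [RingHom.mem_ker, Ideal.Quotient.eq_zero_iff_mem]

end Points

section Separation

variable {G : Type*}

/-- The linear functional on the group algebra extending a function on the group. -/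
noncomputable def groupAlgebraPairing (φ : G → ℂ) : AddMonoidAlgebra ℂ G →ₗ[ℂ] ℂ :=
  Finsupp.linearCombination ℂ φ ∘ₗ (AddMonoidAlgebra.coeffLinearEquiv ℂ).toLinearMap

@[simp]
lemma groupAlgebraPairing_single (φ : G → ℂ) (g : G) (c : ℂ) :
    groupAlgebraPairing φ (AddMonoidAlgebra.single g c) = c * φ g := by
  simp [groupAlgebraPairing]

variable [AddCommGroup G] {r : ℕ} {a : Fin r → G →+ ℂ} {e : Fin r → G}

lemma groupAlgebraPairing_apply_single (l : AddMonoidAlgebra ℂ G →ₗ[ℂ] ℂ) :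
    groupAlgebraPairing (fun g => l (AddMonoidAlgebra.single g 1)) = l := by
  refine LinearMap.ext fun f => ?_
  induction f using AddMonoidAlgebra.induction_linear with
  | zero => simp
  | add f g hf hg => rw [map_add, map_add, hf, hg]
  | single g c =>
    rw [groupAlgebraPairing_single, ← smul_eq_mul, ← map_smul]
    simp

lemma IsRationalBasis.exists_sub_mem_orderIdeal (h : IsRationalBasis a e)
    (ε : AddMonoidAlgebra ℂ G →ₐ[ℂ] ℂ) {k : ℕ} {I : Ideal (AddMonoidAlgebra ℂ G)}
    {p : MvPowerSeries (Fin r) ℂ}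
    (hp : p ∈ I.map (binomialHom a ε) ⊔ orderIdeal r k) :
    ∃ f ∈ I, p - binomialHom a ε f ∈ orderIdeal r k := by
  obtain ⟨p', hp', q, hq, rfl⟩ := Submodule.mem_sup.1 hp
  suffices ∃ f ∈ I, p' - binomialHom a ε f ∈ orderIdeal r k by
    obtain ⟨f, hf, hpf⟩ := this
    exact ⟨f, hf, by simpa [add_sub_right_comm] using add_mem hpf hq⟩
  clear hp hq
  induction hp' using Submodule.span_induction with
  | mem x hx =>
    obtain ⟨f, hf, rfl⟩ := hx
    exact ⟨f, hf, by simp⟩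
  | zero => exact ⟨0, zero_mem _, by simp⟩
  | add x y _ _ hx hy =>
    obtain ⟨f, hf, hxf⟩ := hx
    obtain ⟨g, hg, hyg⟩ := hy
    refine ⟨f + g, add_mem hf hg, ?_⟩
    rw [map_add, add_sub_add_comm]
    exact add_mem hxf hyg
  | smul s x _ hx =>
    obtain ⟨f, hf, hxf⟩ := hx
    refine ⟨polynomialHom e ε (MvPowerSeries.truncTotal k s) * f, Ideal.mul_mem_left _ _ hf, ?_⟩
    rw [map_mul, h.binomialHom_polynomialHom, smul_eq_mul]
    convert add_mem (Ideal.mul_mem_left _ s hxf) (Ideal.mul_mem_right (binomialHom a ε f) _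
      (sub_truncTotal_mem_orderIdeal k s)) using 1
    ring

lemma IsRationalBasis.exists_one_sub_mul_mem (h : IsRationalBasis a e)
    [IsNoetherianRing (AddMonoidAlgebra ℂ G)] (ε : AddMonoidAlgebra ℂ G →ₐ[ℂ] ℂ)
    {I : Ideal (AddMonoidAlgebra ℂ G)} {μ : AddMonoidAlgebra ℂ G}
    (hμ : ∀ k, binomialHom a ε μ ∈ I.map (binomialHom a ε) ⊔ orderIdeal r k) :
    ∃ ρ, ε ρ = 0 ∧ (1 - ρ) * μ ∈ I := by
  have h1 : (Ideal.Quotient.mk I μ) ∈ (⨅ k : ℕ, RingHom.ker ε ^ k • ⊤ :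
      Submodule (AddMonoidAlgebra ℂ G) (AddMonoidAlgebra ℂ G ⧸ I)) := by
    rw [Submodule.mem_iInf]
    intro k
    obtain ⟨f, hf, hμf⟩ := h.exists_sub_mem_orderIdeal ε (hμ k)
    rw [← map_sub, h.binomialHom_mem_orderIdeal_iff] at hμf
    have h2 : Ideal.Quotient.mk I μ = (μ - f) • (1 : AddMonoidAlgebra ℂ G ⧸ I) := by
      change _ = Ideal.Quotient.mk I ((μ - f) * 1)
      rw [mul_one, map_sub, Ideal.Quotient.eq_zero_iff_mem.2 hf, sub_zero]
    rw [h2]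
    exact Submodule.smul_mem_smul hμf trivial
  obtain ⟨⟨ρ, hρ⟩, h2⟩ := ((RingHom.ker ε).mem_iInf_smul_pow_eq_bot_iff _).1 h1
  refine ⟨ρ, hρ, ?_⟩
  change Ideal.Quotient.mk I (ρ * μ) = _ at h2
  rw [← Ideal.Quotient.eq_zero_iff_mem, sub_mul, one_mul, map_sub, h2, sub_self]

lemma exists_mapDomainAlgHom_eq {H : AddSubgroup G} {f : AddMonoidAlgebra ℂ G}
    (hf : (f.coeff.support : Set G) ⊆ H) :
    ∃ f', AddMonoidAlgebra.mapDomainAlgHom ℂ ℂ H.subtype f' = f :=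
  ⟨f.comapDomain H.subtype H.subtype_injective,
    AddMonoidAlgebra.mapDomain_comapDomain (by simpa using hf) H.subtype_injective⟩

lemma binomialHom_mapDomainAlgHom {H : AddSubgroup G} (a : Fin r → G →+ ℂ)
    (ε : AddMonoidAlgebra ℂ G →ₐ[ℂ] ℂ) (f : AddMonoidAlgebra ℂ H) :
    binomialHom a ε (AddMonoidAlgebra.mapDomainAlgHom ℂ ℂ H.subtype f) =
      binomialHom (fun i => (a i).comp H.subtype)
        (ε.comp (AddMonoidAlgebra.mapDomainAlgHom ℂ ℂ H.subtype)) f := by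
  have : (binomialHom a ε).comp (AddMonoidAlgebra.mapDomainAlgHom ℂ ℂ H.subtype) =
      binomialHom (fun i => (a i).comp H.subtype)
        (ε.comp (AddMonoidAlgebra.mapDomainAlgHom ℂ ℂ H.subtype)) := by
    refine algHom_ext_single fun g => ?_
    simp [binomialHom_single]
  exact DFunLike.congr_fun this f

lemma IsRationalBasis.restrict (h : IsRationalBasis a e) {H : AddSubgroup G} (he : ∀ i, e i ∈ H) :
    IsRationalBasis (fun i => (a i).comp H.subtype) fun i => ⟨e i, he i⟩ where
  apply_eq_single := h.apply_eq_single
  exists_nsmul_eq := by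
    rintro ⟨g, hg⟩
    obtain ⟨n, hn, z, hz⟩ := h.exists_nsmul_eq g
    exact ⟨n, hn, z, Subtype.ext (by simpa using hz)⟩

lemma IsRationalBasis.exists_one_sub_mul_mem_of_finset (h : IsRationalBasis a e)
    (ε : AddMonoidAlgebra ℂ G →ₐ[ℂ] ℂ) (t : Finset (AddMonoidAlgebra ℂ G))
    {μ : AddMonoidAlgebra ℂ G}
    (hμ : ∀ k, binomialHom a ε μ ∈ (Ideal.span t).map (binomialHom a ε) ⊔ orderIdeal r k) :
    ∃ ρ, ε ρ = 0 ∧ (1 - ρ) * μ ∈ Ideal.span (t : Set (AddMonoidAlgebra ℂ G)) := by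
  classical
  let S : Finset G := (insert μ t).biUnion (fun f => f.coeff.support) ∪ Finset.univ.image e
  let H := AddSubgroup.closure (S : Set G)
  have hS : (S : Set G) ⊆ H := AddSubgroup.subset_closure
  have he : ∀ i, e i ∈ H := fun i =>
    hS (Finset.mem_coe.2 (Finset.mem_union_right _ (Finset.mem_image_of_mem e (Finset.mem_univ i))))
  have hsupp : ∀ f ∈ insert μ t, (f.coeff.support : Set G) ⊆ H := fun f hf x hx =>
    hS (Finset.mem_coe.2 (Finset.mem_union_left _ (Finset.mem_biUnion.2 ⟨f, hf, hx⟩)))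
  have hfg : AddMonoid.FG H := by
    have : AddGroup.FG H := (AddGroup.fg_iff_addSubgroup_fg H).2 ⟨S, rfl⟩
    exact AddGroup.fg_iff_addMonoid_fg.1 this
  have hN : IsNoetherianRing (AddMonoidAlgebra ℂ H) := Algebra.FiniteType.isNoetherianRing ℂ _
  let ι := AddMonoidAlgebra.mapDomainAlgHom ℂ ℂ H.subtype
  have hlift : ∀ f : AddMonoidAlgebra ℂ G, ∃ f', f ∈ insert μ t → ι f' = f := by
    intro f
    by_cases hf : f ∈ insert μ t
    · obtain ⟨f', hf'⟩ := exists_mapDomainAlgHom_eq (hsupp f hf)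
      exact ⟨f', fun _ => hf'⟩
    · exact ⟨0, fun h => absurd h hf⟩
  choose L hL using hlift
  have hLt : ι '' (L '' t) = t := by
    rw [Set.image_image]
    exact (Set.image_congr fun f hf => hL f (Finset.mem_insert_of_mem hf)).trans (Set.image_id _)
  have hmap : (Ideal.span (L '' t)).map ι = Ideal.span t := by
    rw [Ideal.map_span, hLt]
  have hLμ := hL μ (Finset.mem_insert_self μ t)
  obtain ⟨ρ, hρ, h1⟩ := (h.restrict he).exists_one_sub_mul_mem (ε.comp ι)
    (I := Ideal.span (L '' t)) (μ := L μ) fun k => by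
      convert hμ k using 2
      · rw [Ideal.map_span, Ideal.map_span]
        congr 1
        conv_rhs => rw [← hLt, Set.image_image (binomialHom a ε) ι]
        exact Set.image_congr fun f _ => (binomialHom_mapDomainAlgHom a ε f).symm
      · rw [← binomialHom_mapDomainAlgHom]
        exact congrArg (binomialHom a ε) hLμ
  refine ⟨ι ρ, hρ, ?_⟩
  have h2 := Ideal.mem_map_of_mem ι h1
  rwa [hmap, map_mul, map_sub, map_one, hLμ] at h2

/-- An ideal of the group algebra is the intersection of the kernels of the exponential monomials
which annihilate it. -/
lemma IsRationalBasis.exists_isExpMonomial_pairing_ne_zero (h : IsRationalBasis a e)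
    {I : Ideal (AddMonoidAlgebra ℂ G)} {μ : AddMonoidAlgebra ℂ G} (hμ : μ ∉ I) :
    ∃ φ : G → ℂ, IsExpMonomial φ ∧ (∀ f ∈ I, groupAlgebraPairing φ f = 0) ∧
      groupAlgebraPairing φ μ ≠ 0 := by
  classical
  by_contra! H
  have hJ : Submodule.colon I {μ} ≠ ⊤ := by
    rw [Ne, Ideal.eq_top_iff_one, Submodule.mem_colon_singleton, one_smul]
    exact hμ
  obtain ⟨M, hM, hJM⟩ := Ideal.exists_le_maximal _ hJ
  obtain ⟨ε, rfl⟩ := h.exists_algHom_ker_eq M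
  have h1 : ∀ k, binomialHom a ε μ ∈ I.map (binomialHom a ε) ⊔ orderIdeal r k := by
    intro k
    let T := MvPowerSeries.truncTotal k ∘ₗ (binomialHom a ε).toLinearMap
    have h2 : T μ ∈ (I.restrictScalars ℂ).map T := by
      by_contra h2
      obtain ⟨l, hl, hlI⟩ := Submodule.exists_le_ker_of_notMem h2
      refine hl ?_
      have h3 := H _ (isExpMonomial_dual_truncTotal_binomialHom a ε k l)
      have h4 := groupAlgebraPairing_apply_single (l ∘ₗ T)
      change groupAlgebraPairing (fun g => l (MvPowerSeries.truncTotal k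
        (binomialHom a ε (AddMonoidAlgebra.single g 1)))) = _ at h4
      rw [h4] at h3
      exact h3 fun f hf => hlI (Submodule.mem_map_of_mem hf)
    obtain ⟨f, hf, hfμ⟩ := h2
    have h3 := sub_truncTotal_mem_orderIdeal k (binomialHom a ε (μ - f))
    have h4 : MvPowerSeries.truncTotal k (binomialHom a ε (μ - f)) = 0 := by
      rw [map_sub, map_sub, sub_eq_zero]
      exact hfμ.symm
    rw [h4, MvPolynomial.coe_zero, sub_zero] at h3
    rw [← sub_add_cancel μ f, map_add, add_comm]
    exact Submodule.add_mem_sup (Ideal.mem_map_of_mem _ hf) h3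
  obtain ⟨s, hs, hIs⟩ := (Submodule.fg_span_iff_fg_span_finset_subset _).1
    (IsNoetherian.noetherian (I.map (binomialHom a ε)))
  obtain ⟨t, ht, rfl⟩ := Finset.subset_set_image_iff.1 hs
  obtain ⟨ρ, hρ, h2⟩ := h.exists_one_sub_mul_mem_of_finset ε t (μ := μ) fun k => by
    convert h1 k using 2
    rw [Ideal.map_span, Ideal.map, Ideal.span, Ideal.span, hIs, Finset.coe_image]
  have h3 : 1 - ρ ∈ RingHom.ker ε :=
    hJM (Submodule.mem_colon_singleton.2 (Ideal.span_le.2 ht h2))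
  rw [RingHom.mem_ker, map_sub, map_one, hρ, sub_zero] at h3
  exact one_ne_zero h3

end Separation

section Duality

/-- Finitely supported functionals separate points from closed subspaces of `G → ℂ`. -/
lemma exists_groupAlgebraPairing_ne_zero {G : Type*} {V : Submodule ℂ (G → ℂ)} {f : G → ℂ}
    (hf : f ∉ closure (V : Set (G → ℂ))) :
    ∃ μ, groupAlgebraPairing f μ ≠ 0 ∧ ∀ v ∈ V, groupAlgebraPairing v μ = 0 := by
  classical
  obtain ⟨U, ⟨hfU, hU⟩, hUV⟩ : ∃ U : Set (G → ℂ), (f ∈ U ∧ IsOpen U) ∧ ∀ v ∈ V, v ∉ U :=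
    ⟨(closure (V : Set (G → ℂ)))ᶜ, ⟨hf, isClosed_closure.isOpen_compl⟩,
      fun v hv hvU => hvU (subset_closure hv)⟩
  obtain ⟨F, u, hu, hFU⟩ := isOpen_pi_iff.1 hU f hfU
  let ρ : (G → ℂ) →ₗ[ℂ] (F → ℂ) := LinearMap.funLeft ℂ ℂ Subtype.val
  have hρ : ρ f ∉ V.map ρ := by
    rintro ⟨v, hv, hvf⟩
    refine hUV v hv (hFU fun i hi => ?_)
    have h1 : v i = f i := congrFun hvf ⟨i, hi⟩
    rw [h1]
    exact (hu i hi).2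
  obtain ⟨l, hl, hlV⟩ := Submodule.exists_le_ker_of_notMem hρ
  have h2 : ∀ v, groupAlgebraPairing v
      (∑ i : F, AddMonoidAlgebra.single (i : G) (l (Pi.single i 1))) = l (ρ v) := by
    intro v
    rw [map_sum, LinearMap.pi_apply_eq_sum_univ l (ρ v)]
    refine Finset.sum_congr rfl fun i _ => ?_
    rw [groupAlgebraPairing_single, smul_eq_mul, mul_comm]
    congr 2
    ext j
    simp [Pi.single_apply, eq_comm]
  exact ⟨_, by rwa [h2], fun v hv => by rw [h2]; exact hlV (Submodule.mem_map_of_mem hv)⟩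

variable {G : Type*} [AddCommGroup G]

lemma groupAlgebraPairing_single_mul (φ : G → ℂ) (g : G) (c : ℂ) (f : AddMonoidAlgebra ℂ G) :
    groupAlgebraPairing φ (AddMonoidAlgebra.single g c * f) =
      c * groupAlgebraPairing (fun x => φ (x + g)) f := by
  induction f using AddMonoidAlgebra.induction_linear with
  | zero => simp
  | add f₁ f₂ h₁ h₂ => rw [mul_add, map_add, map_add, h₁, h₂, mul_add]
  | single h d =>
    rw [AddMonoidAlgebra.single_mul_single, groupAlgebraPairing_single,
      groupAlgebraPairing_single, mul_assoc, add_comm g h]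

/-- The ideal of the group algebra annihilating a translation-invariant subspace. -/
noncomputable def annihilatorIdeal (V : Submodule ℂ (G → ℂ))
    (hV : ∀ f ∈ V, ∀ g : G, (fun x => f (x + g)) ∈ V) : Ideal (AddMonoidAlgebra ℂ G) where
  carrier := {μ | ∀ v ∈ V, groupAlgebraPairing v μ = 0}
  zero_mem' v _ := map_zero _
  add_mem' hμ hν v hv := by rw [map_add, hμ v hv, hν v hv, add_zero]
  smul_mem' f μ hμ := by
    induction f using AddMonoidAlgebra.induction_linear with
    | zero => simp
    | add f₁ f₂ h₁ h₂ =>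
      intro v hv
      rw [add_smul, map_add, h₁ v hv, h₂ v hv, add_zero]
    | single g c =>
      intro v hv
      rw [smul_eq_mul, groupAlgebraPairing_single_mul, hμ _ (hV v hv g), mul_zero]

lemma spectralSynthesis_of_finiteDimensional [FiniteDimensional ℚ (ℚ ⊗[ℤ] G)] :
    SpectralSynthesis G := by
  intro V hVc hV f hf
  obtain ⟨r, a, e, h⟩ := exists_isRationalBasis (G := G)
  by_contra hfS
  obtain ⟨μ, hμf, hμS⟩ := exists_groupAlgebraPairing_ne_zero hfS
  obtain ⟨φ, hφ, hφV, hφμ⟩ := h.exists_isExpMonomial_pairing_ne_zero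
    (I := annihilatorIdeal V hV) fun hμ => hμf (hμ f hf)
  refine hφμ (hμS φ (Submodule.subset_span ⟨?_, hφ⟩))
  by_contra hφV'
  rw [← SetLike.mem_coe, ← hVc.closure_eq] at hφV'
  obtain ⟨ν, hνφ, hνV⟩ := exists_groupAlgebraPairing_ne_zero hφV'
  exact hνφ (hφV ν hνV)

end Duality

/-- Laczkovich–Székelyhidi: spectral synthesis holds on a
discrete abelian group iff its torsion-free rank is finite, i.e. `ℚ ⊗[ℤ] G` is
a finite-dimensional `ℚ`-vector space. -/
theorem spectralSynthesis_iff_finite_torsionFree_rank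
    (G : Type*) [AddCommGroup G] :
    SpectralSynthesis G ↔ FiniteDimensional ℚ (ℚ ⊗[ℤ] G) := by
  exact ⟨finiteDimensional_of_spectralSynthesis, fun _ => spectralSynthesis_of_finiteDimensional⟩
end

section
/- Let G be an abelian group (with the discrete topology) whose torsion-free rank is infinite, i.e. the ℚ-vector space ℚ ⊗_ℤ G is infinite-dimensional. Then spectral synthesis fails on G: there exists a translation-invariant ℂ-linear subspace V of ℂ^G, closed in the product (pointwise convergence) topology, such that the ℂ-linear span of the exponential monomials contained in V is not dense in V. -/
open TensorProduct

/-- The translates of a polynomial in fixed functions span a finite-dimensional space. -/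
theorem exists_finiteDimensional_forall_eval_add_mem {X : Type*} {k : ℕ}
    (a : Fin k → X → ℂ) (P : MvPolynomial (Fin k) ℂ) :
    ∃ W : Submodule ℂ (X → ℂ), FiniteDimensional ℂ W ∧
      ∀ v : Fin k → ℂ, (fun x => MvPolynomial.eval (fun i => a i x + v i) P) ∈ W := by
  induction P using MvPolynomial.induction_on with
  | C c =>
    refine ⟨Submodule.span ℂ {fun _ => c}, inferInstance, fun v => ?_⟩
    simp [Submodule.mem_span_singleton_self]
  | add p q hp hq =>
    obtain ⟨W₁, _, h₁⟩ := hp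
    obtain ⟨W₂, _, h₂⟩ := hq
    refine ⟨W₁ ⊔ W₂, inferInstance, fun v => ?_⟩
    simp only [map_add]
    exact Submodule.add_mem_sup (h₁ v) (h₂ v)
  | mul_X p i hp =>
    obtain ⟨W, _, hW⟩ := hp
    refine ⟨W.map (LinearMap.mulLeft ℂ (a i)) ⊔ W, inferInstance, fun v => ?_⟩
    convert Submodule.add_mem_sup (Submodule.mem_map_of_mem (hW v))
      (W.smul_mem (v i) (hW v)) using 1
    ext x
    simp only [map_mul, MvPolynomial.eval_X, Pi.add_apply, LinearMap.mulLeft_apply, Pi.mul_apply,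
      Pi.smul_apply, smul_eq_mul]
    ring

/-- The translates of an exponential monomial span a finite-dimensional space. -/
theorem IsExpMonomial.exists_finiteDimensional {G : Type*} [AddCommGroup G] {f : G → ℂ}
    (hf : IsExpMonomial f) :
    ∃ W : Submodule ℂ (G → ℂ), FiniteDimensional ℂ W ∧ ∀ g, (fun x => f (x + g)) ∈ W := by
  obtain ⟨k, P, a, m, ha, hm, -, hfP⟩ := hf
  obtain ⟨W, _, hW⟩ := exists_finiteDimensional_forall_eval_add_mem a P
  refine ⟨W.map (LinearMap.mulLeft ℂ m), inferInstance, fun g => ?_⟩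
  convert Submodule.mem_map_of_mem (W.smul_mem (m g) (hW fun i => a i g)) using 1
  ext x
  simp only [hfP, ha, hm, LinearMap.mulLeft_apply, Pi.mul_apply, Pi.smul_apply, smul_eq_mul]
  ring

/-- A group of infinite torsion-free rank has infinitely many rational coordinates, with
a dual family of group elements. -/
theorem exists_coordinates_of_infinite_torsionFree_rank {G : Type*} [AddCommGroup G]
    (h : ¬ FiniteDimensional ℚ (ℚ ⊗[ℤ] G)) :
    ∃ s : Set (ℚ ⊗[ℤ] G), Infinite s ∧ ∃ (c : G →+ (s →₀ ℚ)) (e : s → G),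
      ∀ i, c (e i) = Finsupp.single i 1 := by
  have hspan : ⊤ ≤ Submodule.span ℚ (Set.range fun g : G => (1 : ℚ) ⊗ₜ[ℤ] g) := by
    rintro t -
    induction t using TensorProduct.induction_on with
    | zero => exact zero_mem _
    | add x y hx hy => exact add_mem hx hy
    | tmul q g =>
      have : q ⊗ₜ[ℤ] g = q • ((1 : ℚ) ⊗ₜ[ℤ] g) := by simp [TensorProduct.smul_tmul']
      rw [this]
      exact Submodule.smul_mem _ _ (Submodule.subset_span ⟨g, rfl⟩)
  let b := Module.Basis.ofSpan hspan
  have hb : ∀ i, ∃ g : G, (1 : ℚ) ⊗ₜ[ℤ] g = b i := fun i =>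
    Module.Basis.ofSpan_subset hspan (by simp [b])
  choose e he using hb
  refine ⟨_, ?_, b.repr.toAddEquiv.toAddMonoidHom.comp
    (TensorProduct.mk ℤ ℚ G 1).toAddMonoidHom, e, fun i => ?_⟩
  · by_contra hfin
    rw [not_infinite_iff_finite] at hfin
    exact h (Module.Finite.of_basis b)
  · simp [he]

/-- The second difference of `φ` with increments `x`, `y` at the point `z`. -/
def secondDiff {G : Type*} [AddCommGroup G] (x y z : G) : (G → ℂ) →ₗ[ℂ] ℂ :=
  let ev (t : G) : (G → ℂ) →ₗ[ℂ] ℂ := LinearMap.proj t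
  ev (z + x + y) - ev (z + x) - ev (z + y) + ev z

theorem secondDiff_apply {G : Type*} [AddCommGroup G] (x y z : G) (φ : G → ℂ) :
    secondDiff x y z φ = φ (z + x + y) - φ (z + x) - φ (z + y) + φ z := rfl

theorem continuous_secondDiff {G : Type*} [AddCommGroup G] (x y z : G) :
    Continuous (secondDiff x y z) := by
  change Continuous fun φ : G → ℂ => φ (z + x + y) - φ (z + x) - φ (z + y) + φ z
  fun_prop

/-- The functions whose second differences are proportional to `S`, normalized at `g₀`. -/
def quadraticSubmodule {G : Type*} [AddCommGroup G] (S : G → G → ℂ) (g₀ : G) :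
    Submodule ℂ (G → ℂ) :=
  ⨅ (x : G) (y : G) (z : G),
    LinearMap.ker ((S g₀ g₀) • secondDiff x y z - S x y • secondDiff g₀ g₀ 0)

theorem mem_quadraticSubmodule {G : Type*} [AddCommGroup G] {S : G → G → ℂ} {g₀ : G}
    {φ : G → ℂ} : φ ∈ quadraticSubmodule S g₀ ↔
      ∀ x y z, S g₀ g₀ * secondDiff x y z φ = S x y * secondDiff g₀ g₀ 0 φ := by
  simp [quadraticSubmodule, sub_eq_zero]

theorem isClosed_quadraticSubmodule {G : Type*} [AddCommGroup G] (S : G → G → ℂ) (g₀ : G) :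
    IsClosed (quadraticSubmodule S g₀ : Set (G → ℂ)) := by
  have : (quadraticSubmodule S g₀ : Set (G → ℂ)) = ⋂ (x : G) (y : G) (z : G),
      {φ | S g₀ g₀ * secondDiff x y z φ = S x y * secondDiff g₀ g₀ 0 φ} := by
    ext φ
    simp [mem_quadraticSubmodule]
  rw [this]
  exact isClosed_iInter fun x => isClosed_iInter fun y => isClosed_iInter fun z =>
    isClosed_eq (continuous_const.mul (continuous_secondDiff x y z))
      (continuous_const.mul (continuous_secondDiff g₀ g₀ 0))

theorem translate_mem_quadraticSubmodule {G : Type*} [AddCommGroup G] {S : G → G → ℂ} {g₀ : G}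
    (h₀ : S g₀ g₀ ≠ 0) {φ : G → ℂ} (hφ : φ ∈ quadraticSubmodule S g₀) (g : G) :
    (fun x => φ (x + g)) ∈ quadraticSubmodule S g₀ := by
  rw [mem_quadraticSubmodule] at hφ ⊢
  intro x y z
  have key : ∀ x y z, secondDiff x y z (fun t => φ (t + g)) = secondDiff x y (z + g) φ := by
    intro x y z
    simp only [secondDiff_apply, add_right_comm _ _ g]
  rw [key, key, hφ, mul_left_cancel₀ h₀ (hφ g₀ g₀ (0 + g))]

/-- An exponential monomial whose second differences are proportional to a form of infinite rank
has vanishing second differences. -/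
theorem IsExpMonomial.secondDiff_eq_zero {G ι : Type*} [AddCommGroup G] [Infinite ι]
    {S : G → G → ℂ} {g₀ : G} {e : ι → G}
    (hS : LinearIndependent ℂ fun i x => S x (e i)) {φ : G → ℂ}
    (hφ : φ ∈ quadraticSubmodule S g₀) (hexp : IsExpMonomial φ) :
    secondDiff g₀ g₀ 0 φ = 0 := by
  by_contra hc
  rw [mem_quadraticSubmodule] at hφ
  obtain ⟨W, _, hW⟩ := hexp.exists_finiteDimensional
  let W' : Submodule ℂ (G → ℂ) := W ⊔ Submodule.span ℂ {fun _ => 1}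
  have hmem : ∀ i, (fun x => S x (e i)) ∈ W' := by
    intro i
    have h₁ := W.smul_mem (S g₀ g₀ / secondDiff g₀ g₀ 0 φ) (W.sub_mem (hW (e i)) (hW 0))
    have h₂ := Submodule.smul_mem _ (S g₀ g₀ / secondDiff g₀ g₀ 0 φ * (φ 0 - φ (e i)))
      (Submodule.mem_span_singleton_self (R := ℂ) (fun _ : G => (1 : ℂ)))
    convert Submodule.add_mem_sup h₁ h₂ using 1
    ext x
    have := hφ x (e i) 0
    rw [secondDiff_apply x] at this
    simp only [zero_add] at this
    simp only [Pi.add_apply, Pi.smul_apply, Pi.sub_apply, smul_eq_mul, add_zero]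
    field_simp
    linear_combination -this
  have hli : LinearIndependent ℂ fun i => (⟨_, hmem i⟩ : W') :=
    LinearIndependent.of_comp W'.subtype hS
  have := hli.finite
  exact not_finite ι

/-- if the torsion-free rank of the discrete abelian group `G`
is infinite (`ℚ ⊗[ℤ] G` is infinite-dimensional over `ℚ`), then spectral
synthesis fails on `G`. -/
theorem spectralSynthesis_fails_of_infinite_torsionFree_rank
    (G : Type*) [AddCommGroup G]
    (h : ¬ FiniteDimensional ℚ (ℚ ⊗[ℤ] G)) :
    ∃ V : Submodule ℂ (G → ℂ), IsClosed (V : Set (G → ℂ)) ∧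
      (∀ f ∈ V, ∀ g : G, (fun x => f (x + g)) ∈ V) ∧
      ¬ ((V : Set (G → ℂ)) ⊆
          closure (Submodule.span ℂ
            {f : G → ℂ | f ∈ V ∧ IsExpMonomial f} : Set (G → ℂ))) := by
  obtain ⟨s, _, c, e, he⟩ := exists_coordinates_of_infinite_torsionFree_rank h
  let B : G → G → ℂ := fun x y =>
    Finsupp.linearCombination ℚ (fun i => (c y i : ℂ)) (c x)
  have hB : ∀ x y, B x y = (c x).sum fun i q => (q : ℂ) * (c y i : ℂ) := fun x y => by
    simp [B, Finsupp.linearCombination_apply, Rat.smul_def]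
  have hBl : ∀ x x' y, B (x + x') y = B x y + B x' y := fun x x' y => by simp [B]
  have hBr : ∀ x y y', B x (y + y') = B x y + B x y' := fun x y y' => by
    simp [hB, Finsupp.sum, mul_add, Finset.sum_add_distrib]
  let S : G → G → ℂ := fun x y => B x y + B y x
  have hSe : ∀ x i, S x (e i) = 2 * (c x i : ℂ) := fun x i => by
    have h₁ : B (e i) x = c x i := by simp [hB, he]
    have h₂ : B x (e i) = c x i := by
      rw [hB, Finsupp.sum, Finset.sum_eq_single i]
      · simp [he]
      · intro j _ hj
        simp [he, hj.symm]
      · intro hi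
        simp [Finsupp.notMem_support_iff.1 hi]
    simp only [S, h₁, h₂]
    ring
  obtain ⟨i₀⟩ : Nonempty s := inferInstance
  have h₀ : S (e i₀) (e i₀) = 2 := by simp [hSe, he]
  have hli : LinearIndependent ℂ fun i x => S x (e i) := by
    rw [linearIndependent_iff']
    intro t w hw i hi
    have := congrFun hw (e i)
    rw [Finset.sum_apply, Finset.sum_eq_single i] at this
    · simpa [hSe, he] using this
    · intro j _ hj
      simp [hSe, he, hj.symm]
    · exact fun hi' => absurd hi hi'
  have hf : ∀ x y z, secondDiff x y z (fun x => B x x) = S x y := fun x y z => by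
    simp only [secondDiff_apply, hBl, hBr, S]
    ring
  refine ⟨quadraticSubmodule S (e i₀), isClosed_quadraticSubmodule _ _,
    fun φ hφ g => translate_mem_quadraticSubmodule (by simp [h₀]) hφ g, fun hsub => ?_⟩
  have hmem : (fun x => B x x) ∈ quadraticSubmodule S (e i₀) := by
    rw [mem_quadraticSubmodule]
    intro x y z
    rw [hf, hf, mul_comm]
  have hle : Submodule.span ℂ {f | f ∈ quadraticSubmodule S (e i₀) ∧ IsExpMonomial f} ≤
      LinearMap.ker (secondDiff (e i₀) (e i₀) 0) :=
    Submodule.span_le.2 fun φ hφ => hφ.2.secondDiff_eq_zero hli hφ.1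
  have hclosed : IsClosed (LinearMap.ker (secondDiff (e i₀) (e i₀) 0) : Set (G → ℂ)) :=
    isClosed_eq (continuous_secondDiff _ _ _) continuous_const
  have hker : secondDiff (e i₀) (e i₀) 0 (fun x => B x x) = 0 :=
    closure_minimal hle hclosed (hsub hmem)
  rw [hf, h₀] at hker
  exact two_ne_zero hker
end

section
/- Let G be an abelian group (with the discrete topology) whose torsion-free rank is finite, i.e. the ℚ-vector space ℚ ⊗_ℤ G is finite-dimensional. Then spectral synthesis holds on G: for every translation-invariant ℂ-linear subspace V of ℂ^G that is closed in the product (pointwise convergence) topology, the exponential monomials contained in V span a dense subspace of V. -/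
open TensorProduct

theorem Ideal.exists_mem_mul_mem_of_forall_mem_sup_pow {R : Type*} [CommRing R]
    [IsNoetherianRing R] (M J : Ideal R) {x : R} (hx : ∀ n : ℕ, x ∈ J ⊔ M ^ n) :
    ∃ r ∈ M, (1 - r) * x ∈ J := by
  obtain ⟨r, hr⟩ := (M.mem_iInf_smul_pow_eq_bot_iff (Ideal.Quotient.mk J x)).1 <| by
    rw [Submodule.mem_iInf]
    intro n
    obtain ⟨y, hy, z, hz, rfl⟩ := Submodule.mem_sup.1 (hx n)
    have : Ideal.Quotient.mk J (y + z) = z • (1 : R ⧸ J) := by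
      rw [map_add, Ideal.Quotient.eq_zero_iff_mem.2 hy, zero_add, Algebra.smul_def, mul_one]
      rfl
    rw [this]
    exact Submodule.smul_mem_smul hz trivial
  refine ⟨r, r.2, ?_⟩
  rw [← Ideal.Quotient.eq_zero_iff_mem, sub_mul, one_mul, map_sub, sub_eq_zero, ← hr]
  rfl

namespace MvPowerSeries

variable {σ : Type*}

/-- The ideal of formal power series without constant term. -/
noncomputable def varsIdeal (σ : Type*) : Ideal (MvPowerSeries σ ℂ) :=
  Ideal.span (Set.range X)

theorem constantCoeff_eq_zero_of_mem_varsIdeal {f : MvPowerSeries σ ℂ} (hf : f ∈ varsIdeal σ) :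
    constantCoeff f = 0 := by
  have : varsIdeal σ ≤ RingHom.ker (constantCoeff (σ := σ) (R := ℂ)) := by
    rw [varsIdeal, Ideal.span_le]
    rintro _ ⟨i, rfl⟩
    simp
  exact this hf

theorem le_order_of_mem_varsIdeal_pow {f : MvPowerSeries σ ℂ} {n : ℕ}
    (hf : f ∈ varsIdeal σ ^ n) : n ≤ f.order := by
  induction n generalizing f with
  | zero => simp
  | succ n ih =>
    rw [pow_succ] at hf
    refine Submodule.mul_induction_on hf (fun a ha b hb => ?_) (fun a b ha hb => ?_)
    · have h1 : 1 ≤ b.order :=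
        one_le_order_iff_constCoeff_eq_zero.2 (constantCoeff_eq_zero_of_mem_varsIdeal hb)
      push_cast
      exact (add_le_add (ih ha) h1).trans le_order_mul
    · exact (le_min ha hb).trans min_order_le_add

theorem mem_varsIdeal_pow_of_le_order [Fintype σ] {f : MvPowerSeries σ ℂ} {n : ℕ}
    (hf : n ≤ f.order) : f ∈ varsIdeal σ ^ n := by
  classical
  induction n generalizing f with
  | zero => simp
  | succ n ih =>
    have hpick : ∀ β : σ →₀ ℕ, ∃ p : Option σ, (p = none → β = 0) ∧ ∀ i, p = some i → β i ≠ 0 := by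
      intro β
      by_cases h : β = 0
      · exact ⟨none, by simp [h]⟩
      · obtain ⟨i, hi⟩ := Finsupp.ne_iff.1 h
        exact ⟨some i, by simp, by rintro _ ⟨⟩; simpa using hi⟩
    choose pick hnone hsome using hpick
    let g : σ → MvPowerSeries σ ℂ := fun i α =>
      if pick (α + Finsupp.single i 1) = some i then coeff (α + Finsupp.single i 1) f else 0
    have hg : ∀ i α, coeff α (g i) =
        if pick (α + Finsupp.single i 1) = some i then coeff (α + Finsupp.single i 1) f else 0 :=
      fun i α => rfl
    have hfg : f = ∑ i, g i * X i := by
      ext β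
      have hi : ∀ i, coeff β (g i * X i) = if pick β = some i then coeff β f else 0 := by
        intro i
        by_cases hβ : β i = 0
        · rw [if_neg (fun h => hsome β i h hβ), X, coeff_mul_monomial, if_neg]
          intro h
          have := h i
          simp [hβ] at this
        · obtain ⟨α, rfl⟩ : ∃ α, β = α + Finsupp.single i 1 :=
            ⟨β - Finsupp.single i 1, (tsub_add_cancel_of_le (by
              simpa using Nat.one_le_iff_ne_zero.2 hβ)).symm⟩
          rw [X, coeff_add_mul_monomial, mul_one, hg]
      rw [map_sum, Finset.sum_congr rfl fun i _ => hi i]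
      cases hp : pick β with
      | none =>
        obtain rfl := hnone β hp
        have : coeff (0 : σ →₀ ℕ) f = 0 := coeff_of_lt_order (lt_of_lt_of_le (by simp) hf)
        simp [this]
      | some j => simp
    rw [hfg, pow_succ]
    refine Ideal.sum_mem _ fun i _ => Ideal.mul_mem_mul (ih ?_) (Ideal.subset_span ⟨i, rfl⟩)
    refine le_order fun α hα => ?_
    rw [hg]
    split_ifs with h
    · refine coeff_of_lt_order (lt_of_lt_of_le ?_ hf)
      simp only [map_add, Finsupp.degree_single]
      exact_mod_cast Nat.add_lt_add_right (by exact_mod_cast hα) 1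
    · rfl

theorem mem_varsIdeal_pow_iff [Fintype σ] {f : MvPowerSeries σ ℂ} {n : ℕ} :
    f ∈ varsIdeal σ ^ n ↔ n ≤ f.order :=
  ⟨le_order_of_mem_varsIdeal_pow, mem_varsIdeal_pow_of_le_order⟩

theorem mem_varsIdeal_iff [Fintype σ] {f : MvPowerSeries σ ℂ} :
    f ∈ varsIdeal σ ↔ constantCoeff f = 0 := by
  rw [← pow_one (varsIdeal σ), mem_varsIdeal_pow_iff, Nat.cast_one,
    one_le_order_iff_constCoeff_eq_zero]

/-- The formal power series `exp (∑ i, t i * X i)`. -/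
noncomputable def expLinear [Fintype σ] (t : σ → ℂ) : MvPowerSeries σ ℂ :=
  fun α => ∏ i, t i ^ α i / (α i).factorial

theorem coeff_expLinear [Fintype σ] (t : σ → ℂ) (α : σ →₀ ℕ) :
    coeff α (expLinear t) = ∏ i, t i ^ α i / (α i).factorial := rfl

theorem expLinear_zero [Fintype σ] : expLinear (0 : σ → ℂ) = 1 := by
  classical
  ext α
  rw [coeff_expLinear, coeff_one]
  split_ifs with h
  · simp [h]
  · obtain ⟨i, hi⟩ := Finsupp.ne_iff.1 h
    refine Finset.prod_eq_zero (Finset.mem_univ i) ?_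
    simp [zero_pow (by simpa using hi : α i ≠ 0)]

theorem expLinear_add [Fintype σ] (s t : σ → ℂ) :
    expLinear (s + t) = expLinear s * expLinear t := by
  classical
  ext α
  rw [coeff_mul, coeff_expLinear]
  have h : ∀ i, (s + t) i ^ α i / (α i).factorial =
      ∑ p ∈ Finset.HasAntidiagonal.antidiagonal (α i),
        s i ^ p.1 / p.1.factorial * (t i ^ p.2 / p.2.factorial) := by
    intro i
    rw [Pi.add_apply, (Commute.all _ _).add_pow', Finset.sum_div]
    refine Finset.sum_congr rfl fun p hp => ?_
    rw [Finset.HasAntidiagonal.mem_antidiagonal] at hp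
    rw [← hp, nsmul_eq_mul, Nat.choose_symm_add, Nat.add_choose,
      Nat.cast_div (Nat.factorial_mul_factorial_dvd_factorial_add _ _)
      (mod_cast mul_ne_zero (Nat.factorial_ne_zero _) (Nat.factorial_ne_zero _))]
    have := Nat.factorial_ne_zero (p.1 + p.2)
    have := Nat.factorial_ne_zero p.1
    have := Nat.factorial_ne_zero p.2
    push_cast
    field_simp
  rw [Finset.prod_congr rfl fun i _ => h i, Finset.prod_univ_sum]
  symm
  refine Finset.sum_bij' (fun p _ i => (p.1 i, p.2 i))
    (fun q _ => (Finsupp.equivFunOnFinite.symm fun i => (q i).1,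
      Finsupp.equivFunOnFinite.symm fun i => (q i).2)) ?_ ?_ ?_ ?_ ?_
  · intro p hp
    rw [Finset.HasAntidiagonal.mem_antidiagonal] at hp
    simp [← hp]
  · intro q hq
    simp only [Fintype.mem_piFinset, Finset.HasAntidiagonal.mem_antidiagonal] at hq
    rw [Finset.HasAntidiagonal.mem_antidiagonal]
    ext i
    simpa using hq i
  · intro p _
    ext <;> simp
  · intro q _
    ext <;> simp
  · intro p _
    simp [coeff_expLinear, Finset.prod_mul_distrib]

theorem constantCoeff_expLinear [Fintype σ] (t : σ → ℂ) : constantCoeff (expLinear t) = 1 := by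
  rw [← coeff_zero_eq_constantCoeff_apply, coeff_expLinear]
  simp

theorem expLinear_sub_one_sub_mem [Fintype σ] (t : σ → ℂ) :
    expLinear t - 1 - ∑ i, C (t i) * X i ∈ varsIdeal σ ^ 2 := by
  classical
  rw [mem_varsIdeal_pow_iff]
  refine le_order fun α hα => ?_
  have hα' : α.degree < 2 := by exact_mod_cast hα
  rw [map_sub, map_sub, map_sum, coeff_expLinear, coeff_one]
  simp only [coeff_C_mul, coeff_X]
  obtain h | h : α.degree = 0 ∨ α.degree = 1 := by omega
  · obtain rfl : α = 0 := (Finsupp.degree_eq_zero_iff α).1 h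
    simp [eq_comm (a := (0 : σ →₀ ℕ))]
  · obtain ⟨j, rfl⟩ : ∃ j, α = Finsupp.single j 1 := by
      obtain ⟨j, hj⟩ := Finsupp.ne_iff.1 (show α ≠ 0 by rintro rfl; simp at h)
      obtain ⟨β, rfl⟩ : ∃ β, α = β + Finsupp.single j 1 :=
        ⟨α - Finsupp.single j 1, (tsub_add_cancel_of_le (by
          simpa using Nat.one_le_iff_ne_zero.2 hj)).symm⟩
      obtain rfl : β = 0 := (Finsupp.degree_eq_zero_iff β).1 (by simpa using h)
      exact ⟨j, zero_add _⟩
    rw [Finset.prod_eq_single j, Finset.sum_eq_single j]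
    · simp
    · intro i _ hi
      simp [Finsupp.single_left_inj, hi.symm]
    · simp
    · intro i _ hi
      simp [hi.symm]
    · simp

end MvPowerSeries

/-- Elements `basis i` of an abelian group `G` that are `ℚ`-linearly independent and span `G` up to
torsion, together with the corresponding (rational) coordinates. -/
structure RationalCoordinates (σ : Type*) [Fintype σ] [DecidableEq σ]
    (G : Type*) [AddCommGroup G] where
  /-- The coordinates of an element of the group. -/
  coord : G →+ (σ → ℂ)
  /-- The elements with respect to which the coordinates are taken. -/
  basis : σ → G
  coord_basis : ∀ i, coord (basis i) = Pi.single i 1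
  exists_nsmul_eq : ∀ g, ∃ n : ℕ, n ≠ 0 ∧ ∃ k : σ → ℤ, n • g = ∑ i, k i • basis i

namespace RationalCoordinates

open AddMonoidAlgebra MvPowerSeries

variable {σ : Type*} [Fintype σ] [DecidableEq σ] {G : Type*} [AddCommGroup G]

/-- Restriction of coordinates to a subgroup that contains the basis. -/
def restrict (c : RationalCoordinates σ G) (H : AddSubgroup G) (hH : ∀ i, c.basis i ∈ H) :
    RationalCoordinates σ H where
  coord := c.coord.comp H.subtype
  basis i := ⟨c.basis i, hH i⟩
  coord_basis i := c.coord_basis i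
  exists_nsmul_eq g := by
    obtain ⟨n, hn, k, hk⟩ := c.exists_nsmul_eq g
    exact ⟨n, hn, k, Subtype.ext (by simpa using hk)⟩

theorem nsmul_coord (c : RationalCoordinates σ G) {g : G} {n : ℕ} {k : σ → ℤ}
    (h : n • g = ∑ i, k i • c.basis i) (i : σ) : n * c.coord g i = k i := by
  have := congrFun (congrArg c.coord h) i
  simpa [c.coord_basis, Pi.single_apply] using this

section Char

variable (χ : AddMonoidAlgebra ℂ G →ₐ[ℂ] ℂ)

theorem char_single_add (g h : G) : χ (single (g + h) 1) = χ (single g 1) * χ (single h 1) := by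
  rw [← map_mul, single_mul_single, one_mul]

theorem char_single_zero : χ (single (0 : G) 1) = 1 := by
  rw [← one_def, map_one]

theorem char_single_ne_zero (g : G) : χ (single g 1) ≠ 0 := by
  intro h
  have := char_single_add χ g (-g)
  rw [h, add_neg_cancel, char_single_zero, zero_mul] at this
  exact one_ne_zero this

/-- The group element `g`, scaled so that `χ` takes the value `1` on it. -/
noncomputable def normalized (g : G) : AddMonoidAlgebra ℂ G := single g (χ (single g 1))⁻¹

theorem normalized_add (g h : G) :
    normalized χ (g + h) = normalized χ g * normalized χ h := by
  rw [normalized, normalized, normalized, single_mul_single, char_single_add, mul_inv]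

theorem normalized_eq_smul (g : G) :
    normalized χ g = (χ (single g 1))⁻¹ • single g 1 := by
  rw [normalized, smul_single, smul_eq_mul, mul_one]

theorem normalized_zero : normalized χ (0 : G) = 1 := by
  rw [normalized_eq_smul, char_single_zero, inv_one, one_smul, one_def]

theorem char_normalized (g : G) : χ (normalized χ g) = 1 := by
  rw [normalized_eq_smul, map_smul, smul_eq_mul, inv_mul_cancel₀ (char_single_ne_zero χ g)]

theorem single_eq_smul_normalized (g : G) (z : ℂ) :
    single g z = (z * χ (single g 1)) • normalized χ g := by
  rw [normalized, smul_single, smul_eq_mul, mul_assoc, mul_inv_cancel₀ (char_single_ne_zero χ g),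
    mul_one]

theorem normalized_sub_one_mem (g : G) : normalized χ g - 1 ∈ RingHom.ker χ := by
  rw [RingHom.mem_ker, map_sub, char_normalized, map_one, sub_self]

/-- The map sending `g` to the class of `normalized χ g - 1` modulo the square of the kernel
of `χ`. -/
noncomputable def toCotangent : G →+ AddMonoidAlgebra ℂ G ⧸ (RingHom.ker χ ^ 2) where
  toFun g := Ideal.Quotient.mk _ (normalized χ g - 1)
  map_zero' := by rw [normalized_zero, sub_self, map_zero]
  map_add' g h := by
    rw [← map_add, Ideal.Quotient.eq, normalized_add, pow_two]
    have := Ideal.mul_mem_mul (normalized_sub_one_mem χ g) (normalized_sub_one_mem χ h)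
    convert this using 1
    ring

theorem toCotangent_apply (g : G) :
    toCotangent χ g = Ideal.Quotient.mk _ (normalized χ g - 1) := rfl

end Char

variable (c : RationalCoordinates σ G) (χ : AddMonoidAlgebra ℂ G →ₐ[ℂ] ℂ)

/-- The Taylor expansion at the character `χ`: the group element `g` is sent to
`χ g * exp (∑ i, coord g i * X i)`. -/
noncomputable def taylor : AddMonoidAlgebra ℂ G →ₐ[ℂ] MvPowerSeries σ ℂ :=
  AddMonoidAlgebra.lift ℂ (MvPowerSeries σ ℂ) G
    { toFun := fun g => χ (single g.toAdd 1) • expLinear (c.coord g.toAdd)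
      map_one' := by
        rw [toAdd_one, char_single_zero, one_smul, map_zero, expLinear_zero]
      map_mul' := fun g h => by
        rw [toAdd_mul, char_single_add, map_add, expLinear_add, smul_mul_smul_comm] }

theorem taylor_single (g : G) (z : ℂ) :
    c.taylor χ (single g z) = (z * χ (single g 1)) • expLinear (c.coord g) := by
  rw [taylor, lift_single, mul_smul]
  rfl

theorem taylor_normalized (g : G) : c.taylor χ (normalized χ g) = expLinear (c.coord g) := by
  rw [normalized, taylor_single, inv_mul_cancel₀ (char_single_ne_zero χ g), one_smul]

theorem constantCoeff_taylor (x : AddMonoidAlgebra ℂ G) :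
    constantCoeff (c.taylor χ x) = χ x := by
  induction x using AddMonoidAlgebra.induction_linear with
  | zero => simp
  | add x y hx hy => simp only [map_add, hx, hy]
  | single g z =>
    rw [taylor_single, single_eq_smul_normalized χ g z, map_smul χ, char_normalized, smul_eq_mul,
      mul_one, smul_eq_C_mul, map_mul, constantCoeff_expLinear, constantCoeff_C, mul_one]

theorem taylor_mem_varsIdeal_pow {n : ℕ} {x : AddMonoidAlgebra ℂ G}
    (hx : x ∈ RingHom.ker χ ^ n) : c.taylor χ x ∈ varsIdeal σ ^ n := by
  have h : RingHom.ker χ ≤ (varsIdeal σ).comap (c.taylor χ) := fun y hy => by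
    rw [Ideal.mem_comap, mem_varsIdeal_iff, constantCoeff_taylor]
    exact hy
  exact Ideal.le_comap_pow _ n (Ideal.pow_right_mono h n hx)

/-- The local parameters of the group algebra at the character `χ`. -/
noncomputable def param (i : σ) : AddMonoidAlgebra ℂ G := normalized χ (c.basis i) - 1

theorem param_mem (i : σ) : c.param χ i ∈ RingHom.ker χ := normalized_sub_one_mem χ _

theorem taylor_param_sub_X_mem (i : σ) :
    c.taylor χ (c.param χ i) - X i ∈ varsIdeal σ ^ 2 := by
  have := expLinear_sub_one_sub_mem (c.coord (c.basis i))
  rw [param, map_sub, taylor_normalized, map_one]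
  convert this using 2
  rw [c.coord_basis, Finset.sum_eq_single i]
  · simp
  · intro j _ hj
    simp [hj]
  · simp

theorem normalized_sub_one_sub_mem (g : G) :
    normalized χ g - 1 - ∑ i, c.coord g i • c.param χ i ∈ RingHom.ker χ ^ 2 := by
  obtain ⟨n, hn, k, hk⟩ := c.exists_nsmul_eq g
  have hn' : (n : ℂ) ≠ 0 := by exact_mod_cast hn
  have h1 : (n : ℂ) • (normalized χ g - 1) - ∑ i, (k i : ℂ) • c.param χ i ∈
      RingHom.ker χ ^ 2 := by
    have := congrArg (toCotangent χ) hk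
    rw [map_nsmul, map_sum] at this
    simp only [map_zsmul, toCotangent_apply] at this
    rw [← map_nsmul] at this
    simp only [← map_zsmul] at this
    rw [← map_sum, Ideal.Quotient.eq] at this
    simpa only [Nat.cast_smul_eq_nsmul, Int.cast_smul_eq_zsmul, param] using this
  have h2 := Submodule.smul_of_tower_mem _ (n : ℂ)⁻¹ h1
  rw [smul_sub, smul_smul, inv_mul_cancel₀ hn', one_smul, Finset.smul_sum] at h2
  convert h2 using 3 with i
  rw [smul_smul, ← c.nsmul_coord hk i, inv_mul_cancel_left₀ hn']

/-- The degree `n` part of the comparison between the filtration of the group algebra by powers of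
the kernel of `χ` and the order filtration of formal power series. -/
theorem exists_isHomogeneous {n : ℕ} {x : AddMonoidAlgebra ℂ G} (hx : x ∈ RingHom.ker χ ^ n) :
    ∃ P : MvPolynomial σ ℂ, P.IsHomogeneous n ∧
      x - MvPolynomial.aeval (c.param χ) P ∈ RingHom.ker χ ^ (n + 1) ∧
      c.taylor χ x - (P : MvPowerSeries σ ℂ) ∈ varsIdeal σ ^ (n + 1) := by
  have hadd : ∀ {n : ℕ} {x y : AddMonoidAlgebra ℂ G},
      (∃ P : MvPolynomial σ ℂ, P.IsHomogeneous n ∧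
        x - MvPolynomial.aeval (c.param χ) P ∈ RingHom.ker χ ^ (n + 1) ∧
        c.taylor χ x - (P : MvPowerSeries σ ℂ) ∈ varsIdeal σ ^ (n + 1)) →
      (∃ P : MvPolynomial σ ℂ, P.IsHomogeneous n ∧
        y - MvPolynomial.aeval (c.param χ) P ∈ RingHom.ker χ ^ (n + 1) ∧
        c.taylor χ y - (P : MvPowerSeries σ ℂ) ∈ varsIdeal σ ^ (n + 1)) →
      ∃ P : MvPolynomial σ ℂ, P.IsHomogeneous n ∧
        x + y - MvPolynomial.aeval (c.param χ) P ∈ RingHom.ker χ ^ (n + 1) ∧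
        c.taylor χ (x + y) - (P : MvPowerSeries σ ℂ) ∈ varsIdeal σ ^ (n + 1) := by
    rintro n x y ⟨P, hP, hP1, hP2⟩ ⟨Q, hQ, hQ1, hQ2⟩
    refine ⟨P + Q, hP.add hQ, ?_, ?_⟩
    · rw [map_add, add_sub_add_comm]
      exact add_mem hP1 hQ1
    · rw [map_add, MvPolynomial.coe_add, add_sub_add_comm]
      exact add_mem hP2 hQ2
  have hlin : ∀ y : AddMonoidAlgebra ℂ G, ∃ P : MvPolynomial σ ℂ, P.IsHomogeneous 1 ∧
      y - algebraMap ℂ _ (χ y) - MvPolynomial.aeval (c.param χ) P ∈ RingHom.ker χ ^ (1 + 1) ∧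
      c.taylor χ (y - algebraMap ℂ _ (χ y)) - (P : MvPowerSeries σ ℂ) ∈
        varsIdeal σ ^ (1 + 1) := by
    intro y
    induction y using AddMonoidAlgebra.induction_linear with
    | zero => exact ⟨0, MvPolynomial.isHomogeneous_zero _ _ _, by simp, by simp⟩
    | add y z hy hz =>
      have := hadd hy hz
      rwa [sub_add_sub_comm, ← map_add, ← map_add] at this
    | single g z =>
      have key : single g z - algebraMap ℂ (AddMonoidAlgebra ℂ G) (χ (single g z)) =
          (z * χ (single g 1)) • (normalized χ g - 1) := by
        rw [single_eq_smul_normalized χ g z, map_smul, char_normalized, smul_eq_mul, mul_one,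
          smul_sub, Algebra.algebraMap_eq_smul_one]
      rw [key]
      refine ⟨(z * χ (single g 1)) • ∑ i, MvPolynomial.C (c.coord g i) * MvPolynomial.X i,
        ?_, ?_, ?_⟩
      · refine (MvPolynomial.homogeneousSubmodule σ ℂ 1).smul_mem _ ?_
        exact MvPolynomial.IsHomogeneous.sum _ _ _ fun i _ => by
          simpa using (MvPolynomial.isHomogeneous_C σ (c.coord g i)).mul
            (MvPolynomial.isHomogeneous_X ℂ i)
      · rw [map_smul, ← smul_sub]
        refine Submodule.smul_of_tower_mem _ _ ?_
        have := c.normalized_sub_one_sub_mem χ g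
        simpa [Algebra.smul_def] using this
      · rw [map_smul, MvPolynomial.coe_smul, ← smul_sub]
        refine Submodule.smul_of_tower_mem _ _ ?_
        have := expLinear_sub_one_sub_mem (c.coord g)
        rw [map_sub, taylor_normalized, map_one]
        convert this using 2
        rw [← MvPolynomial.coeToMvPowerSeries.ringHom_apply, map_sum]
        simp
  induction n generalizing x with
  | zero =>
    refine ⟨MvPolynomial.C (χ x), MvPolynomial.isHomogeneous_C _ _, ?_, ?_⟩
    · rw [zero_add, pow_one, RingHom.mem_ker, map_sub, MvPolynomial.aeval_C, AlgHom.commutes]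
      simp
    · rw [zero_add, pow_one, mem_varsIdeal_iff, map_sub, constantCoeff_taylor]
      simp
  | succ n ih =>
    have hx' := hx
    rw [pow_succ] at hx'
    refine Submodule.mul_induction_on hx' (fun a ha b hb => ?_) (fun a b => hadd)
    obtain ⟨P, hP, hP1, hP2⟩ := ih ha
    obtain ⟨Q, hQ, hQ1, hQ2⟩ := hlin b
    rw [RingHom.mem_ker.1 hb, map_zero, sub_zero] at hQ1 hQ2
    have hb' : b ∈ RingHom.ker χ ^ 1 := by rwa [pow_one]
    have hP' : MvPolynomial.aeval (c.param χ) P ∈ RingHom.ker χ ^ n := by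
      have := sub_mem ha (Ideal.pow_le_pow_right n.le_succ hP1)
      rwa [sub_sub_cancel] at this
    have hP'' : (P : MvPowerSeries σ ℂ) ∈ varsIdeal σ ^ n := by
      have := sub_mem (c.taylor_mem_varsIdeal_pow χ ha) (Ideal.pow_le_pow_right n.le_succ hP2)
      rwa [sub_sub_cancel] at this
    refine ⟨P * Q, hP.mul hQ, ?_, ?_⟩
    · have h1 := Ideal.mul_mem_mul hP1 hb'
      have h2 := Ideal.mul_mem_mul hP' hQ1
      rw [← pow_add] at h1 h2
      convert add_mem h1 h2 using 1
      rw [map_mul]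
      ring
    · have h1 := Ideal.mul_mem_mul hP2 (c.taylor_mem_varsIdeal_pow χ hb')
      have h2 := Ideal.mul_mem_mul hP'' hQ2
      rw [← pow_add] at h1 h2
      convert add_mem h1 h2 using 1
      rw [map_mul, MvPolynomial.coe_mul]
      ring

theorem mem_ker_pow_iff {n : ℕ} {x : AddMonoidAlgebra ℂ G} :
    x ∈ RingHom.ker χ ^ n ↔ c.taylor χ x ∈ varsIdeal σ ^ n := by
  refine ⟨c.taylor_mem_varsIdeal_pow χ, fun hx => ?_⟩
  induction n with
  | zero => simp
  | succ n ih =>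
    obtain ⟨P, hP, hP1, hP2⟩ := c.exists_isHomogeneous χ (ih (Ideal.pow_le_pow_right n.le_succ hx))
    have hP3 : (P : MvPowerSeries σ ℂ) ∈ varsIdeal σ ^ (n + 1) := by
      have := sub_mem hx hP2
      rwa [sub_sub_cancel] at this
    have : P = 0 := by
      ext α
      by_contra hα
      have h1 := le_order_of_mem_varsIdeal_pow hP3
      have h2 : coeff α (P : MvPowerSeries σ ℂ) ≠ 0 := by simpa using hα
      have h3 := h1.trans (order_le h2)
      have h4 : α.degree = n := by
        rw [Finsupp.degree_eq_weight_one]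
        exact hP (by simpa using hα)
      rw [h4] at h3
      exact absurd h3 (by exact_mod_cast Nat.not_succ_le_self n)
    rwa [this, map_zero, sub_zero] at hP1

theorem exists_taylor_sub_mem_of_mem {n : ℕ} {f : MvPowerSeries σ ℂ} (hf : f ∈ varsIdeal σ ^ n) :
    ∃ x ∈ RingHom.ker χ ^ n, c.taylor χ x - f ∈ varsIdeal σ ^ (n + 1) := by
  have hlin : ∀ {b : MvPowerSeries σ ℂ}, b ∈ varsIdeal σ →
      ∃ y ∈ RingHom.ker χ, c.taylor χ y - b ∈ varsIdeal σ ^ 2 := by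
    intro b hb
    refine Submodule.span_induction ?_ ?_ ?_ ?_ hb
    · rintro _ ⟨i, rfl⟩
      exact ⟨_, c.param_mem χ i, c.taylor_param_sub_X_mem χ i⟩
    · exact ⟨0, zero_mem _, by simp⟩
    · rintro a b _ _ ⟨x, hx, hx'⟩ ⟨y, hy, hy'⟩
      refine ⟨x + y, add_mem hx hy, ?_⟩
      rw [map_add, add_sub_add_comm]
      exact add_mem hx' hy'
    · rintro a b hb ⟨y, hy, hy'⟩
      refine ⟨algebraMap ℂ _ (constantCoeff a) * y, Ideal.mul_mem_left _ _ hy, ?_⟩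
      have ha : C (constantCoeff a) - a ∈ varsIdeal σ := by
        simp [mem_varsIdeal_iff]
      have h1 := Ideal.mul_mem_mul ha (show b ∈ varsIdeal σ from hb)
      rw [← pow_two] at h1
      convert add_mem (Ideal.mul_mem_left _ (C (constantCoeff a)) hy') h1 using 1
      rw [map_mul, AlgHom.commutes, smul_eq_mul, MvPowerSeries.algebraMap_apply,
        Algebra.algebraMap_self, RingHom.id_apply]
      ring
  induction n generalizing f with
  | zero =>
    refine ⟨algebraMap ℂ _ (constantCoeff f), by simp, ?_⟩
    rw [zero_add, pow_one, mem_varsIdeal_iff, map_sub, constantCoeff_taylor, AlgHom.commutes]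
    simp
  | succ n ih =>
    rw [pow_succ] at hf
    refine Submodule.mul_induction_on hf (fun a ha b hb => ?_) ?_
    · obtain ⟨x, hx, hx'⟩ := ih ha
      obtain ⟨y, hy, hy'⟩ := hlin hb
      refine ⟨x * y, ?_, ?_⟩
      · rw [pow_succ]
        exact Ideal.mul_mem_mul hx hy
      · have hy1 : c.taylor χ y ∈ varsIdeal σ ^ 1 :=
          c.taylor_mem_varsIdeal_pow χ (by rwa [pow_one])
        have h1 := Ideal.mul_mem_mul hx' hy1
        have h2 := Ideal.mul_mem_mul ha hy'
        rw [← pow_add] at h1 h2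
        convert add_mem h1 h2 using 1
        rw [map_mul]
        ring
    · rintro a b ⟨x, hx, hx'⟩ ⟨y, hy, hy'⟩
      refine ⟨x + y, add_mem hx hy, ?_⟩
      rw [map_add, add_sub_add_comm]
      exact add_mem hx' hy'

theorem exists_taylor_sub_mem (f : MvPowerSeries σ ℂ) (n : ℕ) :
    ∃ x, c.taylor χ x - f ∈ varsIdeal σ ^ n := by
  induction n with
  | zero => exact ⟨0, by simp⟩
  | succ n ih =>
    obtain ⟨x, hx⟩ := ih
    obtain ⟨y, _, hy⟩ := c.exists_taylor_sub_mem_of_mem χ hx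
    refine ⟨x - y, ?_⟩
    have := neg_mem hy
    rw [map_sub]
    convert this using 1
    ring

theorem exists_mul_mem_of_taylor_mem_of_fg [AddMonoid.FG G] (I : Ideal (AddMonoidAlgebra ℂ G))
    {x : AddMonoidAlgebra ℂ G} (hx : c.taylor χ x ∈ I.map (c.taylor χ)) :
    ∃ s, χ s = 1 ∧ s * x ∈ I := by
  have happrox : ∀ n : ℕ, ∀ f ∈ I.map (c.taylor χ), ∃ y ∈ I,
      f - c.taylor χ y ∈ varsIdeal σ ^ n := by
    intro n f hf
    refine Submodule.span_induction ?_ ?_ ?_ ?_ hf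
    · rintro _ ⟨y, hy, rfl⟩
      exact ⟨y, hy, by simp⟩
    · exact ⟨0, I.zero_mem, by simp⟩
    · rintro f g _ _ ⟨y, hy, hy'⟩ ⟨z, hz, hz'⟩
      refine ⟨y + z, add_mem hy hz, ?_⟩
      rw [map_add, add_sub_add_comm]
      exact add_mem hy' hz'
    · rintro g f _ ⟨y, hy, hy'⟩
      obtain ⟨d, hd⟩ := c.exists_taylor_sub_mem χ g n
      refine ⟨d * y, I.mul_mem_left _ hy, ?_⟩
      convert sub_mem (Ideal.mul_mem_left _ g hy') (Ideal.mul_mem_right (c.taylor χ y) _ hd) using 1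
      rw [map_mul, smul_eq_mul]
      ring
  have : IsNoetherianRing (AddMonoidAlgebra ℂ G) := Algebra.FiniteType.isNoetherianRing ℂ _
  obtain ⟨r, hr, h⟩ := (RingHom.ker χ).exists_mem_mul_mem_of_forall_mem_sup_pow I (x := x) <| by
    intro n
    obtain ⟨y, hy, hy'⟩ := happrox n _ hx
    rw [← map_sub, ← mem_ker_pow_iff] at hy'
    exact Submodule.mem_sup.2 ⟨y, hy, x - y, hy', by ring⟩
  exact ⟨1 - r, by rw [map_sub, map_one, RingHom.mem_ker.1 hr, sub_zero], h⟩

theorem exists_mul_mem_of_taylor_mem (I : Ideal (AddMonoidAlgebra ℂ G))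
    {x : AddMonoidAlgebra ℂ G} (hx : c.taylor χ x ∈ I.map (c.taylor χ)) :
    ∃ s, χ s = 1 ∧ s * x ∈ I := by
  classical
  obtain ⟨T, hT, hxT⟩ := Submodule.mem_span_finite_of_mem_span hx
  obtain ⟨T', hT', rfl⟩ := Finset.subset_set_image_iff.1 hT
  let S : Finset G := (insert x T').biUnion (fun y => y.coeff.support) ∪ Finset.univ.image c.basis
  let H : AddSubgroup G := AddSubgroup.closure S
  have hSH : ∀ g ∈ S, g ∈ H := fun g hg => AddSubgroup.subset_closure hg
  have : AddMonoid.FG H :=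
    AddGroup.fg_iff_addMonoid_fg.1 ((AddGroup.fg_iff_addSubgroup_fg H).2 ⟨S, rfl⟩)
  let c' := c.restrict H fun i => hSH _ (by simp [S])
  let ι : AddMonoidAlgebra ℂ H →ₐ[ℂ] AddMonoidAlgebra ℂ G :=
    AddMonoidAlgebra.mapDomainAlgHom ℂ ℂ H.subtype
  let χ' := χ.comp ι
  have hι : ∀ (h : H) (z : ℂ), ι (single h z) = single (h : G) z := fun h z => by simp [ι]
  have hlift : ∀ y ∈ insert x T', ∃ y', ι y' = y := by
    intro y hy
    refine ⟨∑ g ∈ y.coeff.support.attach, single ⟨g, hSH g ?_⟩ (y.coeff g), ?_⟩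
    · exact Finset.mem_union_left _ (Finset.mem_biUnion.2 ⟨y, hy, g.2⟩)
    · rw [map_sum]
      simp only [hι]
      rw [Finset.sum_attach _ fun g => single g (y.coeff g)]
      exact AddMonoidAlgebra.sum_coeff_single y
  have htaylor : ∀ y, c'.taylor χ' y = c.taylor χ (ι y) := by
    intro y
    induction y using AddMonoidAlgebra.induction_linear with
    | zero => simp
    | add y z hy hz => simp only [map_add, hy, hz]
    | single g z =>
      rw [hι, taylor_single, taylor_single]
      simp only [χ', AlgHom.comp_apply, hι]
      rfl
  obtain ⟨x', hx'⟩ := hlift x (Finset.mem_insert_self _ _)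
  obtain ⟨s, hs, hsx⟩ := c'.exists_mul_mem_of_taylor_mem_of_fg χ' (I.comap ι) (x := x') <| by
    rw [htaylor, hx']
    refine Submodule.span_le.2 ?_ hxT
    intro f hf
    obtain ⟨y, hy, rfl⟩ := Finset.mem_image.1 hf
    obtain ⟨y', hy'⟩ := hlift y (Finset.mem_insert_of_mem hy)
    have hyI : y' ∈ I.comap ι := Ideal.mem_comap.2 (hy' ▸ hT' hy)
    rw [← hy', SetLike.mem_coe, ← htaylor]
    exact Ideal.mem_map_of_mem _ hyI
  exact ⟨ι s, hs, by simpa [hx'] using hsx⟩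

theorem exists_algHom_ker_eq (c : RationalCoordinates σ G) (M : Ideal (AddMonoidAlgebra ℂ G))
    [M.IsMaximal] : ∃ χ : AddMonoidAlgebra ℂ G →ₐ[ℂ] ℂ, RingHom.ker χ = M := by
  let _ : Field (AddMonoidAlgebra ℂ G ⧸ M) := Ideal.Quotient.field M
  let π : AddMonoidAlgebra ℂ G →ₐ[ℂ] AddMonoidAlgebra ℂ G ⧸ M := Ideal.Quotient.mkₐ ℂ M
  let T : Set (AddMonoidAlgebra ℂ G ⧸ M) :=
    Set.range (fun i => π (single (c.basis i) 1)) ∪ Set.range (fun i => π (single (-c.basis i) 1))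
  let A : Subalgebra ℂ (AddMonoidAlgebra ℂ G ⧸ M) := Algebra.adjoin ℂ T
  have hTfin : T.Finite := (Set.finite_range _).union (Set.finite_range _)
  have hmul : ∀ g h : G, π (single (g + h) 1) = π (single g 1) * π (single h 1) := fun g h => by
    rw [← map_mul, single_mul_single, one_mul]
  have hzero : π (single (0 : G) 1) = 1 := by rw [← one_def, map_one]
  let B : AddSubgroup G :=
    { carrier := {g | π (single g 1) ∈ A ∧ π (single (-g) 1) ∈ A}
      zero_mem' := by simp [hzero]
      add_mem' := by
        rintro g h ⟨h1, h2⟩ ⟨h3, h4⟩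
        exact ⟨by rw [hmul]; exact mul_mem h1 h3, by rw [neg_add, hmul]; exact mul_mem h2 h4⟩
      neg_mem' := by
        rintro g ⟨h1, h2⟩
        exact ⟨h2, by rwa [neg_neg]⟩ }
  have hB : ∀ i, c.basis i ∈ B := fun i =>
    ⟨Algebra.subset_adjoin (Or.inl ⟨i, rfl⟩), Algebra.subset_adjoin (Or.inr ⟨i, rfl⟩)⟩
  have hint : ∀ x, IsIntegral A (π x) := by
    intro x
    induction x using AddMonoidAlgebra.induction_linear with
    | zero => rw [map_zero]; exact isIntegral_zero
    | add x y hx hy => rw [map_add]; exact hx.add hy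
    | single g z =>
      obtain ⟨n, hn, k, hk⟩ := c.exists_nsmul_eq g
      have hg : n • g ∈ B := hk ▸ sum_mem fun i _ => zsmul_mem (hB i) _
      refine IsIntegral.of_pow (Nat.pos_of_ne_zero hn) ?_
      have : π (single g z) ^ n ∈ A := by
        rw [← map_pow, single_pow, ← mul_one (z ^ n), ← smul_eq_mul, ← smul_single, map_smul]
        exact A.smul_mem hg.1 _
      exact isIntegral_algebraMap (R := A) (x := ⟨_, this⟩)
  have : Algebra.IsIntegral A (AddMonoidAlgebra ℂ G ⧸ M) := ⟨fun y => by
    obtain ⟨x, rfl⟩ := Ideal.Quotient.mkₐ_surjective ℂ M y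
    exact hint x⟩
  let _ : Field A := (isField_of_isIntegral_of_isField (R := A) (S := AddMonoidAlgebra ℂ G ⧸ M)
    Subtype.val_injective (Field.toIsField _)).toField
  have : Algebra.FiniteType ℂ A :=
    (Subalgebra.fg_iff_finiteType _).1 (Subalgebra.fg_def.2 ⟨T, hTfin, rfl⟩)
  have : Module.Finite ℂ A := finite_of_finite_type_of_isJacobsonRing ℂ A
  have : Algebra.IsIntegral ℂ (AddMonoidAlgebra ℂ G ⧸ M) := Algebra.IsIntegral.trans A
  let e : ℂ ≃ₐ[ℂ] AddMonoidAlgebra ℂ G ⧸ M :=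
    AlgEquiv.ofBijective (Algebra.ofId _ _) IsAlgClosed.algebraMap_bijective_of_isIntegral
  refine ⟨(e.symm : _ →ₐ[ℂ] ℂ).comp π, ?_⟩
  ext x
  simp [RingHom.mem_ker, π, Ideal.Quotient.eq_zero_iff_mem]

theorem exists_of_finiteDimensional (h : FiniteDimensional ℚ (ℚ ⊗[ℤ] G)) :
    ∃ k : ℕ, Nonempty (RationalCoordinates (Fin k) G) := by
  obtain ⟨ι, hι, hmk⟩ : ∃ ι : G →ₗ[ℤ] ℚ ⊗[ℤ] G, IsLocalizedModule (nonZeroDivisors ℤ) ι ∧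
      ∀ g, ι g = 1 ⊗ₜ g :=
    ⟨TensorProduct.mk ℤ ℚ G 1, IsLocalization.tensorProduct_isLocalizedModule _ _, fun _ => rfl⟩
  have hspan : Submodule.span ℚ (Set.range ι) = ⊤ := by
    rw [eq_top_iff]
    rintro x -
    induction x with
    | zero => exact zero_mem _
    | add x y hx hy => exact add_mem hx hy
    | tmul q g =>
      have : q ⊗ₜ[ℤ] g = q • ι g := by
        rw [hmk, TensorProduct.smul_tmul', smul_eq_mul, mul_one]
      rw [this]
      exact Submodule.smul_mem _ _ (Submodule.subset_span ⟨g, rfl⟩)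
  obtain ⟨n, v, e, he⟩ : ∃ (n : ℕ) (v : Module.Basis (Fin n) ℚ (ℚ ⊗[ℤ] G)) (e : Fin n → G),
      ∀ i, ι (e i) = v i := by
    obtain ⟨b, hb, hbspan, hbli⟩ := exists_linearIndependent ℚ (Set.range ι)
    have : Finite b := hbli.finite
    choose e he using fun i : Fin (Nat.card b) => hb ((Finite.equivFin b).symm i).2
    refine ⟨Nat.card b, (Module.Basis.mk hbli (by rw [Subtype.range_coe, hbspan, hspan])).reindex
      (Finite.equivFin b), e, fun i => ?_⟩
    rw [Module.Basis.reindex_apply, Module.Basis.mk_apply]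
    exact he i
  let coord : G →+ (Fin n → ℂ) :=
    { toFun := fun g i => (v.repr (ι g) i : ℂ)
      map_zero' := by
        ext i
        rw [map_zero, map_zero, Finsupp.zero_apply, Rat.cast_zero, Pi.zero_apply]
      map_add' := fun g h => by
        ext i
        rw [map_add, map_add, Finsupp.add_apply, Rat.cast_add, Pi.add_apply] }
  have coord_basis : ∀ i, coord (e i) = Pi.single i 1 := fun i => by
    ext j
    change ((v.repr (ι (e i)) j : ℚ) : ℂ) = _
    rw [he, v.repr_self, Finsupp.single_apply, Pi.single_apply]
    split_ifs <;> simp_all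
  refine ⟨n, ⟨coord, e, coord_basis, fun g => ?_⟩⟩
  obtain ⟨d, hd⟩ := IsLocalization.exist_integer_multiples (nonZeroDivisors ℤ) Finset.univ
    (fun i => v.repr (ι g) i)
  choose! k hk using hd
  have hd0 : (d : ℤ) ≠ 0 := nonZeroDivisors.ne_zero d.2
  have h1 : ι ((d : ℤ) • g) = ι (∑ i, k i • e i) := by
    have h2 : ι (∑ i, k i • e i) = ∑ i, (k i : ℚ) • v i := by
      rw [map_sum]
      refine Finset.sum_congr rfl fun i _ => ?_
      rw [map_zsmul, he, Int.cast_smul_eq_zsmul]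
    have h3 : ι ((d : ℤ) • g) = ((d : ℤ) : ℚ) • ι g := by
      rw [map_zsmul, Int.cast_smul_eq_zsmul]
    rw [h2, h3, ← v.sum_repr (ι g), Finset.smul_sum]
    refine Finset.sum_congr rfl fun i _ => ?_
    have := hk i (Finset.mem_univ i)
    rw [smul_smul, ← eq_intCast (algebraMap ℤ ℚ) (k i), this]
    congr 1
  obtain ⟨s, hs⟩ := IsLocalizedModule.exists_of_eq (S := nonZeroDivisors ℤ) (f := ι) h1
  have hs0 : (s : ℤ) ≠ 0 := nonZeroDivisors.ne_zero s.2
  refine ⟨((s : ℤ) * d).natAbs, by simp [hs0, hd0], fun i => ((s : ℤ) * d).sign * (s * k i), ?_⟩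
  have h2 : ((s : ℤ) * d) • g = ∑ i, (s * k i) • e i := by
    simp only [mul_smul, ← Finset.smul_sum]
    exact hs
  rw [← natCast_zsmul, ← Int.sign_mul_self_eq_natAbs, mul_smul, h2, Finset.smul_sum]
  simp only [mul_smul]

theorem isExpMonomial_comp_taylor {k : ℕ} (c : RationalCoordinates (Fin k) G)
    (χ : AddMonoidAlgebra ℂ G →ₐ[ℂ] ℂ) (l : MvPowerSeries (Fin k) ℂ →ₗ[ℂ] ℂ) {n : ℕ}
    (hl : ∀ f ∈ varsIdeal (Fin k) ^ n, l f = 0) :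
    IsExpMonomial fun g => l (c.taylor χ (single g 1)) := by
  let D := (Finsupp.finite_of_degree_lt (σ := Fin k) n).toFinset
  have hexp : ∀ t, l (expLinear t) =
      ∑ α ∈ D, (∏ i, t i ^ α i / (α i).factorial) * l (monomial α 1) := by
    intro t
    have : expLinear t - ∑ α ∈ D, coeff α (expLinear t) • monomial α 1 ∈
        varsIdeal (Fin k) ^ n := by
      rw [mem_varsIdeal_pow_iff]
      refine le_order fun α hα => ?_
      have hα' : α ∈ D := by simpa [D] using hα
      rw [map_sub, map_sum, Finset.sum_eq_single α]
      · simp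
      · intro β _ hβ
        simp [coeff_monomial, hβ.symm]
      · exact fun h => absurd hα' h
    have := hl _ this
    rw [map_sub, sub_eq_zero, map_sum] at this
    rw [this]
    simp only [map_smul, smul_eq_mul, coeff_expLinear]
  refine ⟨k, ∑ α ∈ D, MvPolynomial.monomial α (l (monomial α 1) / ∏ i, ((α i).factorial : ℂ)),
    fun i g => c.coord g i, fun g => χ (single g 1), fun i x y => by simp,
    char_single_add χ, char_single_ne_zero χ, fun g => ?_⟩
  beta_reduce
  rw [taylor_single, map_smul, hexp, one_mul, smul_eq_mul, mul_comm, map_sum]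
  congr 1
  refine Finset.sum_congr rfl fun α _ => ?_
  rw [MvPolynomial.eval_monomial, Finsupp.prod_fintype _ _ (by simp), Finset.prod_div_distrib]
  ring

theorem exists_isExpMonomial_of_notMem {k : ℕ} (c : RationalCoordinates (Fin k) G)
    {I : Ideal (AddMonoidAlgebra ℂ G)} {x : AddMonoidAlgebra ℂ G} (hx : x ∉ I) :
    ∃ l : AddMonoidAlgebra ℂ G →ₗ[ℂ] ℂ, (∀ y ∈ I, l y = 0) ∧ l x ≠ 0 ∧
      IsExpMonomial fun g => l (single g 1) := by
  let J : Ideal (AddMonoidAlgebra ℂ G) := Submodule.comap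
    (LinearMap.toSpanSingleton (AddMonoidAlgebra ℂ G) (AddMonoidAlgebra ℂ G) x) I
  have hJ : ∀ s, s ∈ J ↔ s * x ∈ I := fun s => Iff.rfl
  have hJtop : J ≠ ⊤ := by
    rw [Ideal.ne_top_iff_one, hJ, one_mul]
    exact hx
  obtain ⟨M, hM, hJM⟩ := J.exists_le_maximal hJtop
  obtain ⟨χ, rfl⟩ := c.exists_algHom_ker_eq M
  have h1 : c.taylor χ x ∉ I.map (c.taylor χ) := by
    intro h
    obtain ⟨s, hs, hsx⟩ := c.exists_mul_mem_of_taylor_mem χ I h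
    have := RingHom.mem_ker.1 (hJM ((hJ s).2 hsx))
    exact one_ne_zero (hs.symm.trans this)
  obtain ⟨n, hn⟩ : ∃ n : ℕ, c.taylor χ x ∉ I.map (c.taylor χ) ⊔ varsIdeal (Fin k) ^ n := by
    by_contra! h
    obtain ⟨r, hr, hrx⟩ := Ideal.exists_mem_mul_mem_of_forall_mem_sup_pow _ _ h
    have hu : IsUnit (1 - r) := by
      rw [MvPowerSeries.isUnit_iff_constantCoeff, map_sub,
        constantCoeff_eq_zero_of_mem_varsIdeal hr]
      simp
    exact h1 ((Ideal.unit_mul_mem_iff_mem _ hu).1 hrx)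
  obtain ⟨l, hl, hker⟩ := Submodule.exists_le_ker_of_notMem
    (p := (I.map (c.taylor χ) ⊔ varsIdeal (Fin k) ^ n).restrictScalars ℂ) hn
  refine ⟨l ∘ₗ (c.taylor χ).toLinearMap, fun y hy => ?_, hl, ?_⟩
  · exact hker (Ideal.mem_sup_left (Ideal.mem_map_of_mem _ hy))
  · exact c.isExpMonomial_comp_taylor χ l fun f hf => hker (Ideal.mem_sup_right hf)

end RationalCoordinates

section Duality

open AddMonoidAlgebra

variable {G : Type*}

/-- The linear extension of a function on `G` to the group algebra. -/
noncomputable def AddMonoidAlgebra.pairing (f : G → ℂ) : AddMonoidAlgebra ℂ G →ₗ[ℂ] ℂ :=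
  Finsupp.linearCombination ℂ f ∘ₗ (coeffLinearEquiv ℂ).toLinearMap

theorem AddMonoidAlgebra.pairing_single (f : G → ℂ) (g : G) (z : ℂ) :
    pairing f (single g z) = z * f g := by
  simp [pairing]

theorem AddMonoidAlgebra.pairing_single_mul [AddCommGroup G] (f : G → ℂ) (g : G) (z : ℂ)
    (x : AddMonoidAlgebra ℂ G) :
    pairing f (single g z * x) = z * pairing (fun h => f (h + g)) x := by
  induction x using AddMonoidAlgebra.induction_linear with
  | zero => simp
  | add x y hx hy => simp only [mul_add, map_add, hx, hy]
  | single h w => rw [single_mul_single, pairing_single, pairing_single, add_comm g h, mul_assoc]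

theorem mem_closure_of_forall_pairing_eq_zero (W : Submodule ℂ (G → ℂ)) {f : G → ℂ}
    (hf : ∀ x : AddMonoidAlgebra ℂ G, (∀ w ∈ W, pairing w x = 0) → pairing f x = 0) :
    f ∈ closure (W : Set (G → ℂ)) := by
  classical
  have h : ∀ S : Finset G, ∃ w ∈ W, ∀ s ∈ S, w s = f s := by
    intro S
    let ρ : (G → ℂ) →ₗ[ℂ] (S → ℂ) := LinearMap.funLeft ℂ ℂ (Subtype.val : S → G)
    by_cases hS : ρ f ∈ W.map ρ
    · obtain ⟨w, hw, hwf⟩ := hS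
      exact ⟨w, hw, fun s hs => congrFun hwf ⟨s, hs⟩⟩
    · exfalso
      obtain ⟨l, hl, hker⟩ := Submodule.exists_le_ker_of_notMem hS
      have key : ∀ w, l (ρ w) =
          pairing w (∑ s : S, single (s : G) (l (fun j => if s = j then 1 else 0))) := by
        intro w
        rw [map_sum]
        simp only [pairing_single]
        rw [LinearMap.pi_apply_eq_sum_univ l (ρ w)]
        exact Finset.sum_congr rfl fun s _ => mul_comm _ _
      refine hl ?_
      rw [key]
      refine hf _ fun w hw => ?_
      rw [← key]
      exact hker (Submodule.mem_map_of_mem hw)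
  choose w hw hwf using h
  refine mem_closure_of_tendsto (f := w) (b := Filter.atTop) ?_ (Filter.Eventually.of_forall hw)
  rw [tendsto_pi_nhds]
  intro g
  refine tendsto_const_nhds.congr' ?_
  filter_upwards [Filter.eventually_ge_atTop {g}] with S hS
  exact (hwf S g (hS (Finset.mem_singleton_self g))).symm

/-- The annihilator in the group algebra of a translation-invariant space of functions. -/
noncomputable def translationAnnihilator [AddCommGroup G] (V : Submodule ℂ (G → ℂ))
    (hV : ∀ f ∈ V, ∀ g : G, (fun x => f (x + g)) ∈ V) : Ideal (AddMonoidAlgebra ℂ G) where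
  carrier := {x | ∀ f ∈ V, pairing f x = 0}
  zero_mem' f _ := map_zero _
  add_mem' {x y} hx hy f hf := by rw [map_add, hx f hf, hy f hf, add_zero]
  smul_mem' r x hx := by
    induction r using AddMonoidAlgebra.induction_linear with
    | zero => intro f _; simp
    | add r s hr hs => intro f hf; rw [add_smul, map_add, hr f hf, hs f hf, add_zero]
    | single g z => intro f hf; rw [smul_eq_mul, pairing_single_mul, hx _ (hV f hf g), mul_zero]

end Duality

/-- if the torsion-free rank of the discrete abelian group `G`
is finite (`ℚ ⊗[ℤ] G` is a finite-dimensional `ℚ`-vector space), then spectral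
synthesis holds on `G`. -/
theorem spectralSynthesis_of_finite_torsionFree_rank
    (G : Type*) [AddCommGroup G]
    (h : FiniteDimensional ℚ (ℚ ⊗[ℤ] G)) :
    ∀ V : Submodule ℂ (G → ℂ), IsClosed (V : Set (G → ℂ)) →
      (∀ f ∈ V, ∀ g : G, (fun x => f (x + g)) ∈ V) →
      (V : Set (G → ℂ)) ⊆
        closure (Submodule.span ℂ
          {f : G → ℂ | f ∈ V ∧ IsExpMonomial f} : Set (G → ℂ)) := by
  intro V hclosed hV f hf
  obtain ⟨k, ⟨c⟩⟩ := RationalCoordinates.exists_of_finiteDimensional h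
  refine mem_closure_of_forall_pairing_eq_zero _ fun x hx => ?_
  by_contra hfx
  have hxI : x ∉ translationAnnihilator V hV := fun h => hfx (h f hf)
  obtain ⟨l, hl, hlx, hexp⟩ := c.exists_isExpMonomial_of_notMem hxI
  have hpair : ∀ y,
      AddMonoidAlgebra.pairing (fun g => l (AddMonoidAlgebra.single g 1)) y = l y := by
    intro y
    induction y using AddMonoidAlgebra.induction_linear with
    | zero => simp
    | add y z hy hz => simp only [map_add, hy, hz]
    | single g z =>
      rw [AddMonoidAlgebra.pairing_single, ← smul_eq_mul, ← map_smul,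
        AddMonoidAlgebra.smul_single, smul_eq_mul, mul_one]
  have hlV : (fun g => l (AddMonoidAlgebra.single g 1)) ∈ V := by
    have := mem_closure_of_forall_pairing_eq_zero V
      (f := fun g => l (AddMonoidAlgebra.single g 1)) fun y hy => by
        rw [hpair]
        exact hl y hy
    rwa [hclosed.closure_eq] at this
  refine hlx ?_
  rw [← hpair]
  exact hx _ (Submodule.subset_span ⟨hlV, hexp⟩)
end

section
/- Let G be an abelian group, H a subgroup of G, and B : H × H → ℂ a symmetric bi-additive function, i.e. B(x,y) = B(y,x), B(x+x',y) = B(x,y) + B(x',y), and B(x,y+y') = B(x,y) + B(x,y') for all x, x', y, y' ∈ H. Then there exists a symmetric bi-additive function B̄ : G × G → ℂ whose restriction to H × H equals B. -/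
/-- A homomorphism from a subgroup of an abelian group to a rational vector space extends to the
whole group. -/
theorem AddSubgroup.exists_extension_of_rat_module {G M : Type*} [AddCommGroup G]
    [AddCommGroup M] [Module ℚ M] (H : AddSubgroup G) (f : H →+ M) :
    ∃ g : G →+ M, ∀ x : H, g x = f x := by
  let _ : DivisibleBy M ℤ :=
    { div := fun m n => (n : ℚ)⁻¹ • m
      div_zero := fun m => by simp
      div_cancel := fun {n} m hn => by
        rw [← Int.cast_smul_eq_zsmul ℚ, smul_inv_smul₀ (Int.cast_ne_zero.mpr hn)] }
  obtain ⟨g, hg⟩ := (Module.Baer.of_divisible M).extension_property_addMonoidHom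
    H.subtype H.subtype_injective f
  exact ⟨g, fun x => DFunLike.congr_fun hg x⟩

/-- A biadditive map on a subgroup of an abelian group with values in a rational vector space
extends to the whole group. -/
theorem AddSubgroup.exists_biadditive_extension_of_rat_module {G M : Type*} [AddCommGroup G]
    [AddCommGroup M] [Module ℚ M] (H : AddSubgroup G) (B : H →+ H →+ M) :
    ∃ C : G →+ G →+ M, ∀ x y : H, C x y = B x y := by
  obtain ⟨C₁, hC₁⟩ := H.exists_extension_of_rat_module B
  obtain ⟨C₂, hC₂⟩ := H.exists_extension_of_rat_module C₁.flip
  exact ⟨C₂.flip, fun x y => by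
    rw [AddMonoidHom.flip_apply, hC₂, AddMonoidHom.flip_apply, hC₁]⟩


/-- every symmetric bi-additive function `B : H × H → ℂ` on a
subgroup `H` of an abelian group `G` extends to a symmetric bi-additive
function on `G × G`. -/
theorem symmetric_biadditive_extension
    {G : Type*} [AddCommGroup G] (H : AddSubgroup G) (B : H → H → ℂ)
    (hsymm : ∀ x y, B x y = B y x)
    (haddl : ∀ x x' y, B (x + x') y = B x y + B x' y)
    (haddr : ∀ x y y', B x (y + y') = B x y + B x y') :
    ∃ Bbar : G → G → ℂ,
      (∀ x y, Bbar x y = Bbar y x) ∧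
      (∀ x x' y, Bbar (x + x') y = Bbar x y + Bbar x' y) ∧
      (∀ x y y', Bbar x (y + y') = Bbar x y + Bbar x y') ∧
      ∀ x y : H, Bbar x y = B x y := by
  obtain ⟨C, hC⟩ := H.exists_biadditive_extension_of_rat_module
    (AddMonoidHom.mk' (fun x => AddMonoidHom.mk' (B x) (haddr x))
      fun x x' => AddMonoidHom.ext (haddl x x'))
  have hC' : ∀ x y : H, C x y = B x y := hC
  refine ⟨fun x y => (C x y + C y x) / 2, fun x y => ?_, fun x x' y => ?_, fun x y y' => ?_,
    fun x y => ?_⟩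
  · simp only [add_comm]
  · simp only [map_add, AddMonoidHom.add_apply]
    ring
  · simp only [map_add, AddMonoidHom.add_apply]
    ring
  · simp only [hC', hsymm y x, add_self_div_two]
end
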